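/- Let S be the spectrum of an integral Noetherian strictly henselian local ring with closed point s and generic point η, and let f: X → S be a semistable morphism. Then every irreducible component of the non-smooth locus of the generic fibre X_η is geometrically irreducible. -/

import Mathlib

/-!
Common infrastructure for formalizing "Néron models of jacobians over base schemes of
dimension greater than 1" (semistable morphisms, strata, dual graphs, alignment,
specialisation maps, Cartier/Weil divisors, Picard data, Néron models).

Notes on design choices (Mathlib has no algebraic spaces, no Picard functor, no strict
henselisation and no excellent rings):
* Algebraic spaces are replaced by schemes throughout.
* The label of a point of a semistable morphism over a strictly henselian local base is
  taken in the local ring itself (which agrees with the strict henselisation there), and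
  alignment over a general base is defined via base change to arbitrary strictly
  henselian Noetherian local test rings (which is equivalent to the definition via
  geometric points, since the strict henselisations are among such test rings).
* Excellence of the base is beyond current Mathlib and is omitted from hypotheses.
-/

open AlgebraicGeometry CategoryTheory CategoryTheory.Limits

universe u

noncomputable section

namespace NeronSemistable

/-! ### Local properties of morphisms of schemes -/

/-- `f` is smooth at the point `x` if it is smooth on an open neighbourhood of `x`. -/
def SmoothAtPt {X S : Scheme.{u}} (f : X ⟶ S) (x : X) : Prop :=
  ∃ U : X.Opens, x ∈ U ∧ IsSmooth (U.ι ≫ f)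

/-- `f` is étale at the point `x` if it is étale on an open neighbourhood of `x`. -/
def EtaleAtPt {X S : Scheme.{u}} (f : X ⟶ S) (x : X) : Prop :=
  ∃ U : X.Opens, x ∈ U ∧ IsEtale (U.ι ≫ f)

/-- `f` is flat at `x` if the induced map of stalks is flat. -/
def FlatAtPt {X S : Scheme.{u}} (f : X ⟶ S) (x : X) : Prop :=
  letI := (f.stalkMap x).hom.toAlgebra
  Module.Flat (S.presheaf.stalk (f.base x)) (X.presheaf.stalk x)

/-- A morphism of schemes is flat if it is flat at every point. -/
def SchemeFlat {X S : Scheme.{u}} (f : X ⟶ S) : Prop := ∀ x : X, FlatAtPt f x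

/-- The non-smooth locus of a morphism, as a set of points. -/
def NonSmoothLocus {X S : Scheme.{u}} (f : X ⟶ S) : Set X := {x | ¬ SmoothAtPt f x}

/-! ### Fibres -/

/-- The scheme-theoretic fibre `X_s` of `f : X ⟶ S` over `s ∈ S`. -/
def fiberScheme {X S : Scheme.{u}} (f : X ⟶ S) (s : S) : Scheme.{u} :=
  pullback f (S.fromSpecResidueField s)

/-- The projection from the fibre `X_s` to `X`. -/
def fiberι {X S : Scheme.{u}} (f : X ⟶ S) (s : S) : fiberScheme f s ⟶ X :=
  pullback.fst f (S.fromSpecResidueField s)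

/-- The structure morphism of the fibre `X_s` to the spectrum of the residue field. -/
def fiberRes {X S : Scheme.{u}} (f : X ⟶ S) (s : S) :
    fiberScheme f s ⟶ Spec (S.residueField s) :=
  pullback.snd f (S.fromSpecResidueField s)

/-- `f : X ⟶ S` has geometrically connected fibres. -/
def GeomConnFibers {X S : Scheme.{u}} (f : X ⟶ S) : Prop :=
  ∀ (K : Type u) [Field K] [IsAlgClosed K] (g : Spec (CommRingCat.of K) ⟶ S),
    ConnectedSpace ↑(pullback f g)

/-- A subset `T` of a scheme `Z` over (the spectrum of) a field object `k` is geometrically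
irreducible if its preimage in `Z ×_k K` is irreducible for every field extension `K` of `k`. -/
def GeomIrreducibleOver (k : CommRingCat.{u}) {Z : Scheme.{u}} (g : Z ⟶ Spec k)
    (T : Set Z) : Prop :=
  ∀ (K : Type u) [Field K] (ψ : k ⟶ CommRingCat.of K),
    IsIrreducible ((pullback.fst g (Spec.map ψ)).base ⁻¹' T)

/-! ### Standard local models `Spec R[x₁,…,xₙ]/(x₁⋯x_l − b)` and semistable morphisms -/

open MvPolynomial in
/-- The ring `R[x₁,…,xₙ]/(x₁⋯x_l − b)`. -/
abbrev stdRing (R : Type u) [CommRing R] (n l : ℕ) (b : R) : Type u :=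
  MvPolynomial (Fin n) R ⧸
    Ideal.span {(∏ i : Fin n, if (i : ℕ) < l then X i else 1) - C b}

/-- The standard local model as a scheme. -/
def stdScheme (R : Type u) [CommRing R] (n l : ℕ) (b : R) : Scheme.{u} :=
  Spec (CommRingCat.of (stdRing R n l b))

/-- The structure morphism of the standard local model. -/
def stdSpec (R : CommRingCat.{u}) (n l : ℕ) (b : R) : stdScheme ↥R n l b ⟶ Spec R :=
  Spec.map (CommRingCat.ofHom (algebraMap ↥R (stdRing ↥R n l b)))

open MvPolynomial in
/-- The class of the coordinate `x_i` in the standard model. -/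
def stdCoord (R : Type u) [CommRing R] (n l : ℕ) (b : R) (i : Fin n) : stdRing R n l b :=
  Ideal.Quotient.mk _ (X i)

/-- The data of a commutative diagram exhibiting `f` étale-locally at `x` as a standard
semistable model `Spec R[x₁,…,xₙ]/(x₁⋯x_l − b)`, as in the definition of a semistable
morphism. -/
structure ChartData {X S : Scheme.{u}} (f : X ⟶ S) (x : X) where
  R : CommRingCat.{u}
  n : ℕ
  l : ℕ
  hln : l ≤ n
  b : ↥R
  etS : Spec R ⟶ S
  etS_etale : IsEtale etS
  s' : ↑(Spec R)
  hs' : etS.base s' = f.base x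
  U : Scheme.{u}
  U_conn : ConnectedSpace ↑U
  gX : U ⟶ X
  gX_etale : IsEtale gX
  x' : ↑U
  hx' : gX.base x' = x
  gT : U ⟶ stdScheme ↥R n l b
  gT_etale : IsEtale gT
  comm : gT ≫ stdSpec R n l b ≫ etS = gX ≫ f

/-- A morphism is semistable if it is proper with geometrically connected fibres and admits
standard semistable charts étale-locally at every point. -/
def IsSemistable {X S : Scheme.{u}} (f : X ⟶ S) : Prop :=
  IsProper f ∧ GeomConnFibers f ∧ ∀ x : X, Nonempty (ChartData f x)

/-! ### Local rings: regularity, strict henselianity -/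

/-- The closed point of `Spec R` for a local ring `R` (with the local-ring witness passed
explicitly). -/
def closedPt (R : CommRingCat.{u}) (h : IsLocalRing ↥R) : ↑(Spec R) :=
  (@IsLocalRing.closedPoint ↥R _ h : PrimeSpectrum ↥R)

/-- A commutative ring is strictly henselian local if it is a henselian local ring with
separably closed residue field. -/
structure StrictlyHenselianLocal (A : Type u) [CommRing A] : Prop where
  toIsLocalRing : IsLocalRing A
  henselian : HenselianLocalRing A
  sepClosedResidue : @IsSepClosed (@IsLocalRing.ResidueField A _ toIsLocalRing)
      (@IsLocalRing.ResidueField.field A _ toIsLocalRing)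

/-- A Noetherian local ring is regular if its maximal ideal is generated by
`dim R` many elements. -/
def IsRegularLocal (A : Type u) [CommRing A] : Prop :=
  IsNoetherianRing A ∧ ∃ (h : IsLocalRing A) (s : Finset A),
    Ideal.span (s : Set A) = @IsLocalRing.maximalIdeal A _ h ∧
    (s.card : WithBot (WithTop ℕ)) = ringKrullDim A

/-- A scheme is regular if all its local rings are regular (and it is locally Noetherian). -/
def IsRegularScheme (X : Scheme.{u}) : Prop :=
  IsLocallyNoetherian X ∧ ∀ x : X, IsRegularLocal ↥(X.presheaf.stalk x)

/-! ### Labels of points of semistable morphisms over a local base -/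

/-- Over an affine base `Spec R`, the point `x` (of the non-smooth locus of its fibre) has
label `(b)`, `b ∈ R`, if there is a local chart
`U ⟶ Spec R[x₁,…,xₙ]/(x₁⋯x_l − b)` at `x` (with the coordinates `x₁,…,x_l` contained in
the prime ideal of the image of `x`).  Over a strictly henselian local ring this agrees
with the usual label in the strict henselisation. -/
def HasLabel {R : CommRingCat.{u}} {X : Scheme.{u}} (f : X ⟶ Spec R) (x : X) (b : ↥R) :
    Prop :=
  ∃ (n l : ℕ), l ≤ n ∧
    ∃ (U : Scheme.{u}) (gX : U ⟶ X) (x' : ↑U) (gT : U ⟶ stdScheme ↥R n l b),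
      IsEtale gX ∧ IsEtale gT ∧ gX.base x' = x ∧
      gT ≫ stdSpec R n l b = gX ≫ f ∧
      ∀ i : Fin n, (i : ℕ) < l → stdCoord ↥R n l b i ∈ (gT.base x').asIdeal

/-! ### Reduced closed subschemes and strata of fibres -/

/-- A realisation of the closed subset `C ⊆ X` as a reduced closed subscheme of `X`
(such a realisation always exists and is unique up to unique isomorphism). -/
structure ReducedClosedSubscheme (X : Scheme.{u}) (C : Set X) where
  Z : Scheme.{u}
  ι : Z ⟶ X
  isClosedImmersion : IsClosedImmersion ι
  reduced : IsReduced Z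
  range : Set.range ι.base = C

/-- `Sing` is the sequence of iterated non-smooth loci of a scheme `Z` over a field object
`k`: `Sing 0 = Z`, and `Sing (r+1)` is the non-smooth locus over `k` of `Sing r` endowed
with its reduced induced closed subscheme structure. -/
def IsSingSeq {k : CommRingCat.{u}} {Z : Scheme.{u}} (g : Z ⟶ Spec k)
    (Sing : ℕ → Set Z) : Prop :=
  Sing 0 = Set.univ ∧
  ∀ r : ℕ, ∃ W : ReducedClosedSubscheme Z (Sing r),
    Sing (r + 1) = W.ι.base '' {z | ¬ SmoothAtPt (W.ι ≫ g) z}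

/-- `T` is an `r`-stratum of the scheme `Z` over the field object `k`: an irreducible
component of the smooth locus of the `r`-th iterated non-smooth locus of `Z` over `k`. -/
def IsStratum {k : CommRingCat.{u}} {Z : Scheme.{u}} (g : Z ⟶ Spec k) (r : ℕ)
    (T : Set Z) : Prop :=
  ∃ Sing : ℕ → Set Z, IsSingSeq g Sing ∧
    ∃ W : ReducedClosedSubscheme Z (Sing r),
      ∃ T' ∈ irreducibleComponents {z : W.Z // SmoothAtPt (W.ι ≫ g) z},
        T = W.ι.base '' (Subtype.val '' T')

/-! ### Dual graphs, cycles and alignment over a local base -/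

/-- The (1-)stratum `T` of the closed fibre of `f` has label `b` (i.e. some — equivalently,
by constancy of labels, any — point of it has label `b`). -/
def StratumHasLabel {R : CommRingCat.{u}} {X : Scheme.{u}} (f : X ⟶ Spec R)
    (s : ↑(Spec R)) (T : Set (fiberScheme f s)) (b : ↥R) : Prop :=
  ∃ z ∈ T, HasLabel f ((fiberι f s).base z) b

/-- A cycle in the dual graph of the fibre of `f : X ⟶ Spec R` over the point `s`:
a cyclic sequence of pairwise distinct vertices (irreducible components of the fibre)
joined by pairwise distinct edges (1-strata, each contained in exactly the two
neighbouring components). -/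
structure GraphCycle {R : CommRingCat.{u}} {X : Scheme.{u}} (f : X ⟶ Spec R)
    (s : ↑(Spec R)) where
  N : ℕ
  hN : 0 < N
  v : Fin N → Set (fiberScheme f s)
  hv : ∀ i, v i ∈ irreducibleComponents ↑(fiberScheme f s)
  v_inj : Function.Injective v
  T : Fin N → Set (fiberScheme f s)
  hT : ∀ i, IsStratum (fiberRes f s) 1 (T i)
  T_inj : Function.Injective T
  incident : ∀ i : Fin N,
    {c ∈ irreducibleComponents ↑(fiberScheme f s) | T i ⊆ c} =
      {v i, v (⟨((i : ℕ) + 1) % N, Nat.mod_lt _ hN⟩ : Fin N)}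

/-- `f : X ⟶ Spec R` (for `R` local) is aligned at the closed point: for any cycle in the
dual graph of the closed fibre, the labels of any two of its edges admit equal positive
powers (as ideals of `R`). -/
def AlignedOver {R : CommRingCat.{u}} (hR : IsLocalRing ↥R) {X : Scheme.{u}}
    (f : X ⟶ Spec R) : Prop :=
  ∀ (c : GraphCycle f (closedPt R hR)) (i j : Fin c.N) (bi bj : ↥R),
    StratumHasLabel f (closedPt R hR) (c.T i) bi →
    StratumHasLabel f (closedPt R hR) (c.T j) bj →
    ∃ n m : ℕ, 0 < n ∧ 0 < m ∧ Ideal.span {bi} ^ n = Ideal.span {bj} ^ m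

/-- `f : X ⟶ S` is aligned (at every geometric point): the base change of `f` to any
Noetherian strictly henselian local test ring over `S` is aligned at the closed point.
(Taking the test ring to be a strict henselisation of a local ring of `S` recovers the
notion of alignment at a geometric point of `S`.) -/
def IsAligned {X S : Scheme.{u}} (f : X ⟶ S) : Prop :=
  ∀ (A : CommRingCat.{u}), IsNoetherianRing ↥A →
    ∀ (h : StrictlyHenselianLocal ↥A) (g : Spec A ⟶ S),
      AlignedOver h.toIsLocalRing (pullback.snd f g)

/-! ### The specialisation relation on irreducible components of fibres -/

/-- The irreducible component `Z` of the fibre `X_s` specialises (under `sp_{s→η}`) to the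
irreducible component `Y` of `X_η`, i.e. `Z` is contained in the fibre over `s` of the
closure of `Y` in `X`. -/
def spRel {X S : Scheme.{u}} (f : X ⟶ S) (s η : S)
    (Z : Set (fiberScheme f s)) (Y : Set (fiberScheme f η)) : Prop :=
  (fiberι f s).base '' Z ⊆ closure ((fiberι f η).base '' Y)

/-- `C` is a connected component of the subset `A` of a topological space. -/
def IsConnCompOf {α : Type u} [TopologicalSpace α] (A C : Set α) : Prop :=
  ∃ x : ↥A, C = Subtype.val '' connectedComponent x
/-! ### Orders of vanishing, Weil divisors and Cartier divisors -/

/-- `a` has order (length of `A/(a)` as an `A`-module, computed as the Krull dimension of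
the lattice of submodules) equal to `m`. -/
def elemOrd (A : Type u) [CommRing A] (a : A) (m : ℕ) : Prop :=
  Order.krullDim (Submodule A (A ⧸ Ideal.span {a})) = (m : ℕ∞)

/-- The order of vanishing of `a ∈ R` at the point `p` of `Spec R` is `k`. -/
def IsLocOrd {R : Type u} [CommRing R] (a : R) (p : PrimeSpectrum R) (k : ℕ) : Prop :=
  elemOrd (Localization (@Ideal.primeCompl R _ p.asIdeal p.2))
    (algebraMap R (Localization (@Ideal.primeCompl R _ p.asIdeal p.2)) a) k

/-- `z` is a divisorial point of `X`: its local ring has Krull dimension 1, i.e. the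
closure of `z` is a prime divisor on `X`. -/
def IsDivisorialPt (X : Scheme.{u}) (z : X) : Prop :=
  ringKrullDim ↥(X.presheaf.stalk z) = 1

/-- The order of vanishing at `z ∈ V` of the section `h ∈ Γ(X, V)` is `m`. -/
def germOrd {X : Scheme.{u}} (V : X.Opens) (h : Γ(X, V)) (z : X) (hz : z ∈ V)
    (m : ℕ) : Prop :=
  elemOrd ↥(X.presheaf.stalk z) (X.presheaf.germ V z hz h) m

/-- A Weil divisor on `X` is recorded as a coefficient function on points of `X`; only its
values at divisorial points are relevant. `CutsOn D V h₁ h₂` says that on the open set `V`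
the divisor `D` is cut out by the pair of nonzerodivisors `(h₁, h₂)` (i.e. `D` equals
`div h₁ − div h₂` on `V`). -/
def CutsOn {X : Scheme.{u}} (D : X → ℤ) (V : X.Opens) (h₁ h₂ : Γ(X, V)) : Prop :=
  h₁ ∈ nonZeroDivisors Γ(X, V) ∧ h₂ ∈ nonZeroDivisors Γ(X, V) ∧
  ∀ z (hz : z ∈ V), IsDivisorialPt X z →
    ∀ m₁ m₂ : ℕ, germOrd V h₁ z hz m₁ → germOrd V h₂ z hz m₂ →
      D z = (m₁ : ℤ) - (m₂ : ℤ)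

/-- The Weil divisor `D` is a Cartier divisor: it is cut out locally by ratios of
nonzerodivisor sections. -/
def IsCartierDiv {X : Scheme.{u}} (D : X → ℤ) : Prop :=
  ∀ x : X, ∃ V : X.Opens, x ∈ V ∧ ∃ h₁ h₂ : Γ(X, V), CutsOn D V h₁ h₂

/-- `D'` is the pullback along `p : W ⟶ X` of the Cartier divisor `D` on `X`: at every
divisorial point of `W`, the coefficient of `D'` is computed by pulling back local
equations of `D`. -/
def IsDivPullback {W X : Scheme.{u}} (p : W ⟶ X) (D : X → ℤ) (D' : W → ℤ) : Prop :=
  ∀ w : W, IsDivisorialPt W w →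
    ∀ (V : X.Opens) (hw : p.base w ∈ V) (h₁ h₂ : Γ(X, V)), CutsOn D V h₁ h₂ →
      ∀ m₁ m₂ : ℕ, germOrd (p ⁻¹ᵁ V) (p.app V h₁) w hw m₁ →
        germOrd (p ⁻¹ᵁ V) (p.app V h₂) w hw m₂ →
          D' w = (m₁ : ℤ) - (m₂ : ℤ)

/-- Two Weil divisors on `X` are linearly equivalent if their difference is the divisor of
a global ratio of nonzerodivisor sections. -/
def LinEquivDiv {X : Scheme.{u}} (D D' : X → ℤ) : Prop :=
  ∃ h₁ h₂ : Γ(X, ⊤), h₁ ∈ nonZeroDivisors Γ(X, ⊤) ∧ h₂ ∈ nonZeroDivisors Γ(X, ⊤) ∧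
    ∀ z : X, IsDivisorialPt X z →
      ∀ m₁ m₂ : ℕ, germOrd ⊤ h₁ z trivial m₁ → germOrd ⊤ h₂ z trivial m₂ →
        D z - D' z = (m₁ : ℤ) - (m₂ : ℤ)

/-! ### Group schemes over a base (group objects via generalized points) -/

/-- A group scheme over `S`: a scheme `G/S` together with multiplication, unit and
inverse morphisms satisfying the group axioms (expressed on generalized points). -/
structure GroupSchemeOver (S : Scheme.{u}) where
  G : Scheme.{u}
  π : G ⟶ S
  e : S ⟶ G
  e_sec : e ≫ π = 𝟙 S
  mul : pullback π π ⟶ G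
  mul_over : mul ≫ π = pullback.fst π π ≫ π
  inv : G ⟶ G
  inv_over : inv ≫ π = π
  mul_assoc' : ∀ {T : Scheme.{u}} (a b c : T ⟶ G) (hab : a ≫ π = b ≫ π)
    (hbc : b ≫ π = c ≫ π)
    (h₁ : (pullback.lift a b hab ≫ mul) ≫ π = c ≫ π)
    (h₂ : a ≫ π = (pullback.lift b c hbc ≫ mul) ≫ π),
    pullback.lift (pullback.lift a b hab ≫ mul) c h₁ ≫ mul =
      pullback.lift a (pullback.lift b c hbc ≫ mul) h₂ ≫ mul
  one_mul' : ∀ {T : Scheme.{u}} (a : T ⟶ G) (h : (a ≫ π ≫ e) ≫ π = a ≫ π),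
    pullback.lift (a ≫ π ≫ e) a h ≫ mul = a
  mul_one' : ∀ {T : Scheme.{u}} (a : T ⟶ G) (h : a ≫ π = (a ≫ π ≫ e) ≫ π),
    pullback.lift a (a ≫ π ≫ e) h ≫ mul = a
  inv_mul' : ∀ {T : Scheme.{u}} (a : T ⟶ G) (h : (a ≫ inv) ≫ π = a ≫ π),
    pullback.lift (a ≫ inv) a h ≫ mul = a ≫ π ≫ e
/-! ### Line bundles via Čech gluing data, and the relative Picard scheme -/

/-- A line bundle on a scheme `Y`, presented by Čech gluing data: an open cover together
with unit transition functions satisfying the cocycle condition. -/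
structure GluingData (Y : Scheme.{u}) where
  I : Type u
  U : I → Y.Opens
  covers : iSup U = ⊤
  t : ∀ i j : I, Γ(Y, U i ⊓ U j)
  t_isUnit : ∀ i j, IsUnit (t i j)
  cocycle : ∀ i j k : I,
    (Y.presheaf.map (homOfLE (inf_le_left : (U i ⊓ U j) ⊓ U k ≤ U i ⊓ U j)).op) (t i j) *
    (Y.presheaf.map (homOfLE (le_inf (inf_le_left.trans inf_le_right)
      (inf_le_right : (U i ⊓ U j) ⊓ U k ≤ U k))).op) (t j k) =
    (Y.presheaf.map (homOfLE (le_inf (inf_le_left.trans inf_le_left)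
      (inf_le_right : (U i ⊓ U j) ⊓ U k ≤ U k))).op) (t i k)

/-- The trivial line bundle. -/
def trivialGluing (Y : Scheme.{u}) : GluingData Y where
  I := PUnit
  U := fun _ => ⊤
  covers := by simp
  t := fun _ _ => 1
  t_isUnit := fun _ _ => isUnit_one
  cocycle := by intro i j k; simp

/-- `D'` is the pullback of the gluing data `D` along `φ : Z ⟶ Y`. -/
def IsPullbackGluing {Z Y : Scheme.{u}} (φ : Z ⟶ Y) (D : GluingData Y)
    (D' : GluingData Z) : Prop :=
  ∃ eqv : D.I ≃ D'.I,
    (∀ i, D'.U (eqv i) = φ ⁻¹ᵁ D.U i) ∧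
    ∀ (i j : D.I) (hle : D'.U (eqv i) ⊓ D'.U (eqv j) ≤ φ ⁻¹ᵁ (D.U i ⊓ D.U j)),
      D'.t (eqv i) (eqv j) =
        (Z.presheaf.map (homOfLE hle).op) ((φ.app (D.U i ⊓ D.U j)) (D.t i j))

/-- Two gluing data on `Y` present isomorphic line bundles: on a common refinement their
transition functions differ by a coboundary. -/
def GluingIso {Y : Scheme.{u}} (D₁ D₂ : GluingData Y) : Prop :=
  ∃ (K : Type u) (W : K → Y.Opens) (_ : iSup W = ⊤)
    (r₁ : K → D₁.I) (r₂ : K → D₂.I)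
    (_ : ∀ k, W k ≤ D₁.U (r₁ k)) (_ : ∀ k, W k ≤ D₂.U (r₂ k))
    (s : ∀ k, Γ(Y, W k)),
    (∀ k, IsUnit (s k)) ∧
    ∀ (k k' : K) (hle₁ : W k ⊓ W k' ≤ D₁.U (r₁ k) ⊓ D₁.U (r₁ k'))
      (hle₂ : W k ⊓ W k' ≤ D₂.U (r₂ k) ⊓ D₂.U (r₂ k')),
      (Y.presheaf.map (homOfLE hle₁).op) (D₁.t (r₁ k) (r₁ k')) *
        (Y.presheaf.map (homOfLE (inf_le_right : W k ⊓ W k' ≤ W k')).op) (s k') =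
      (Y.presheaf.map (homOfLE (inf_le_left : W k ⊓ W k' ≤ W k)).op) (s k) *
        (Y.presheaf.map (homOfLE hle₂).op) (D₂.t (r₂ k) (r₂ k'))

/-- `D₃` is (isomorphic to) the tensor product of the line bundles presented by `D₁` and
`D₂`: on a common refinement, its transition functions are the products of those of `D₁`
and `D₂`, up to a coboundary. -/
def TensorIso {Y : Scheme.{u}} (D₁ D₂ D₃ : GluingData Y) : Prop :=
  ∃ (K : Type u) (W : K → Y.Opens) (_ : iSup W = ⊤)
    (r₁ : K → D₁.I) (r₂ : K → D₂.I) (r₃ : K → D₃.I)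
    (_ : ∀ k, W k ≤ D₁.U (r₁ k)) (_ : ∀ k, W k ≤ D₂.U (r₂ k))
    (_ : ∀ k, W k ≤ D₃.U (r₃ k)) (s : ∀ k, Γ(Y, W k)),
    (∀ k, IsUnit (s k)) ∧
    ∀ (k k' : K) (hle₁ : W k ⊓ W k' ≤ D₁.U (r₁ k) ⊓ D₁.U (r₁ k'))
      (hle₂ : W k ⊓ W k' ≤ D₂.U (r₂ k) ⊓ D₂.U (r₂ k'))
      (hle₃ : W k ⊓ W k' ≤ D₃.U (r₃ k) ⊓ D₃.U (r₃ k')),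
      (Y.presheaf.map (homOfLE hle₃).op) (D₃.t (r₃ k) (r₃ k')) *
        (Y.presheaf.map (homOfLE (inf_le_right : W k ⊓ W k' ≤ W k')).op) (s k') =
      (Y.presheaf.map (homOfLE (inf_le_left : W k ⊓ W k' ≤ W k)).op) (s k) *
        ((Y.presheaf.map (homOfLE hle₁).op) (D₁.t (r₁ k) (r₁ k')) *
          (Y.presheaf.map (homOfLE hle₂).op) (D₂.t (r₂ k) (r₂ k')))

/-- An fppf cover: faithfully flat and locally of finite presentation. -/
def IsFppfCover {T' T : Scheme.{u}} (c : T' ⟶ T) : Prop :=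
  SchemeFlat c ∧ LocallyOfFinitePresentation c ∧ Function.Surjective c.base

/-- For `g : T ⟶ S` and `c : T' ⟶ T`, the induced morphism `X ×_S T' ⟶ X ×_S T`. -/
def inducedMap {X S T T' : Scheme.{u}} (f : X ⟶ S) (g : T ⟶ S) (c : T' ⟶ T) :
    pullback f (c ≫ g) ⟶ pullback f g :=
  pullback.map f (c ≫ g) f g (𝟙 X) c (𝟙 S) (by simp) (by simp)

/-- Data exhibiting a group scheme `P/S` as (a scheme representing) the relative Picard
functor `Pic_{X/S}`, i.e. the fppf sheafification of `T ↦ Pic(X ×_S T)`: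
a natural assignment `toPic` from line bundles on `X ×_S T` to `T`-points of `P`, which is
compatible with pullback, isomorphism and tensor products, sends the trivial bundle to the
unit section, and is fppf-locally bijective. -/
structure PicardData {X S : Scheme.{u}} (f : X ⟶ S) extends GroupSchemeOver S where
  lfp : LocallyOfFinitePresentation π
  toPic : ∀ {T : Scheme.{u}} (g : T ⟶ S), GluingData (pullback f g) → (T ⟶ G)
  toPic_over : ∀ {T : Scheme.{u}} (g : T ⟶ S) (D : GluingData (pullback f g)),
    toPic g D ≫ π = g
  toPic_trivial : ∀ {T : Scheme.{u}} (g : T ⟶ S),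
    toPic g (trivialGluing _) = g ≫ e
  toPic_pullback : ∀ {T T' : Scheme.{u}} (g : T ⟶ S) (c : T' ⟶ T)
    (D : GluingData (pullback f g)) (D' : GluingData (pullback f (c ≫ g))),
    IsPullbackGluing (inducedMap f g c) D D' → toPic (c ≫ g) D' = c ≫ toPic g D
  toPic_iso : ∀ {T : Scheme.{u}} (g : T ⟶ S) (D₁ D₂ : GluingData (pullback f g)),
    GluingIso D₁ D₂ → toPic g D₁ = toPic g D₂
  toPic_mul : ∀ {T : Scheme.{u}} (g : T ⟶ S) (D₁ D₂ D₃ : GluingData (pullback f g))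
    (_ : TensorIso D₁ D₂ D₃)
    (h : toPic g D₁ ≫ π = toPic g D₂ ≫ π),
    pullback.lift (toPic g D₁) (toPic g D₂) h ≫ mul = toPic g D₃
  locally_surjective : ∀ {T : Scheme.{u}} (g : T ⟶ S) (h : T ⟶ G), h ≫ π = g →
    ∃ (T' : Scheme.{u}) (c : T' ⟶ T), IsFppfCover c ∧
      ∃ D' : GluingData (pullback f (c ≫ g)), toPic (c ≫ g) D' = c ≫ h
  locally_injective : ∀ {T : Scheme.{u}} (g : T ⟶ S)
    (D₁ D₂ : GluingData (pullback f g)), toPic g D₁ = toPic g D₂ →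
    ∃ (T' : Scheme.{u}) (c : T' ⟶ T), IsFppfCover c ∧
      ∃ (D₁' D₂' : GluingData (pullback f (c ≫ g))) (E : GluingData T')
        (E' E₂ : GluingData (pullback f (c ≫ g))),
        IsPullbackGluing (inducedMap f g c) D₁ D₁' ∧
        IsPullbackGluing (inducedMap f g c) D₂ D₂' ∧
        IsPullbackGluing (pullback.snd f (c ≫ g)) E E' ∧
        TensorIso D₁' E' E₂ ∧ GluingIso E₂ D₂'

/-! ### `Pic⁰`, scheme-theoretic closures and Néron models -/

/-- The fibrewise identity component of a group scheme `P/S` over the open set `U ⊆ S`: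
the set of points lying over `U` and belonging to the connected component of the unit
section inside their fibre. -/
def pic0Set {S : Scheme.{u}} (P : GroupSchemeOver S) (U : S.Opens) : Set P.G :=
  {p | P.π.base p ∈ U ∧
    p ∈ connectedComponentIn (P.π.base ⁻¹' {P.π.base p}) (P.e.base (P.π.base p))}

/-- `(Z, ι)` is the scheme-theoretic closure (scheme-theoretic image) of `g : A ⟶ P`:
the smallest closed subscheme of `P` through which `g` factors. -/
structure IsSchClosure {A P : Scheme.{u}} (g : A ⟶ P) (Z : Scheme.{u}) (ι : Z ⟶ P) :
    Prop where
  isClosedImmersion : IsClosedImmersion ι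
  factors : ∃ g' : A ⟶ Z, g' ≫ ι = g
  smallest : ∀ (W : Scheme.{u}) (κ : W ⟶ P), IsClosedImmersion κ →
    (∃ w : A ⟶ W, w ≫ κ = g) → ∃ ρ : Z ⟶ W, ρ ≫ κ = ι

/-- A Néron model over `S` of a smooth "abelian" scheme `A` over the dense open `U ⊆ S`:
a smooth separated scheme `N/S` with an isomorphism `N ×_S U ≅ A` over `U`, satisfying
the Néron mapping property.  (The paper allows `N` to be an algebraic space; algebraic
spaces are not available in Mathlib, so schemes are used.) -/
structure NeronModelData {S : Scheme.{u}} (U : S.Opens) {A : Scheme.{u}}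
    (aU : A ⟶ U.toScheme) where
  N : Scheme.{u}
  ν : N ⟶ S
  smooth : IsSmooth ν
  separated : IsSeparated ν
  isoU : (ν ⁻¹ᵁ U).toScheme ≅ A
  isoU_over : isoU.hom ≫ aU = ν ∣_ U
  mapping : ∀ (T : Scheme.{u}) (t : T ⟶ S), IsSmooth t →
    ∀ (φU : (t ⁻¹ᵁ U).toScheme ⟶ A), φU ≫ aU = t ∣_ U →
      ∃! φ : T ⟶ N, φ ≫ ν = t ∧
        (t ⁻¹ᵁ U).ι ≫ φ = φU ≫ isoU.inv ≫ (ν ⁻¹ᵁ U).ι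

/-! ### Projective morphisms -/

attribute [local instance] MvPolynomial.gradedAlgebra

/-- Projective `n`-space (over `Spec (ULift ℤ)`). -/
def projSpace (n : ℕ) : Scheme.{u} :=
  Proj (MvPolynomial.homogeneousSubmodule (Fin (n + 1)) (ULift.{u} ℤ))

/-- Relative projective `n`-space over `S`. -/
def projSpaceOver (S : Scheme.{u}) (n : ℕ) : Scheme.{u} :=
  pullback (terminal.from (projSpace.{u} n)) (terminal.from S)

/-- A morphism is projective if it factors as a closed immersion into some relative
projective space over the base. -/
def IsProjectiveMorphism {X S : Scheme.{u}} (f : X ⟶ S) : Prop :=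
  ∃ (n : ℕ) (ι : X ⟶ projSpaceOver S n),
    IsClosedImmersion ι ∧ ι ≫ pullback.snd _ _ = f
end NeronSemistable
end

section
open Polynomial IsLocalRing

theorem hens_section {R R' : Type*} [CommRing R] [HenselianLocalRing R] [CommRing R'] [Algebra R R']
    [Algebra.Etale R R'] (Q : Ideal R') [Q.IsPrime] [Q.LiesOver (maximalIdeal R)]
    (h : Function.Surjective (algebraMap R Q.ResidueField)) :
    ∃ σ : R' →ₐ[R] R, ∀ z, algebraMap R Q.ResidueField (σ z) = algebraMap R' Q.ResidueField z := by
  have hmem : ∀ r : R, algebraMap R Q.ResidueField r = 0 ↔ r ∈ maximalIdeal R := by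
    intro r
    rw [IsScalarTower.algebraMap_apply R R' Q.ResidueField, Ideal.algebraMap_residueField_eq_zero,
      Ideal.mem_of_liesOver Q (maximalIdeal R)]
  obtain ⟨f, hf, hst⟩ := Algebra.IsEtaleAt.exists_isStandardEtale (R := R) Q
  let P : StandardEtalePresentation R (Localization.Away f) := Classical.ofNonempty
  -- the map from the localization to the residue field
  let φ : Localization.Away f →ₐ[R] Q.ResidueField :=
    IsLocalization.liftAlgHom (M := .powers f) (f := IsScalarTower.toAlgHom R R' Q.ResidueField) (by
      rintro ⟨_, n, rfl⟩
      simp only [map_pow]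
      refine IsUnit.pow _ (isUnit_iff_ne_zero.mpr ?_)
      simpa [Ideal.algebraMap_residueField_eq_zero] using hf)
  have hφ : ∀ z, φ (algebraMap R' _ z) = algebraMap R' Q.ResidueField z := fun z ↦ by simp [φ]
  obtain ⟨a₀, ha₀⟩ := h (φ P.x)
  have hm := P.hasMap.map φ
  rw [← ha₀] at hm
  have hd := hm.isUnit_derivative_f
  obtain ⟨a, ha, haa⟩ := HenselianLocalRing.is_henselian P.f P.monic_f a₀
    (by
      rw [← hmem, ← Polynomial.aeval_algebraMap_apply_eq_algebraMap_eval]; exact hm.1) (by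
      by_contra hu
      rw [← mem_nonunits_iff, ← mem_maximalIdeal, ← hmem,
        ← Polynomial.aeval_algebraMap_apply_eq_algebraMap_eval] at hu
      rw [hu] at hd
      exact hd.ne_zero rfl)
  have haa' : algebraMap R Q.ResidueField a = algebraMap R Q.ResidueField a₀ := by
    rw [← sub_eq_zero, ← map_sub, hmem]; exact haa
  have hmap : P.HasMap a := by
    refine ⟨by simpa [Polynomial.coe_aeval_eq_eval] using ha, ?_⟩
    by_contra hu
    rw [← mem_nonunits_iff, ← mem_maximalIdeal, ← hmem, Polynomial.coe_aeval_eq_eval,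
        ← Polynomial.aeval_algebraMap_apply_eq_algebraMap_eval, haa'] at hu
    have := hm.2
    rw [hu] at this
    exact this.ne_zero rfl
  let σ' : Localization.Away f →ₐ[R] R := (P.lift a hmap).comp P.equivRing.toAlgHom
  have hσ' : (IsScalarTower.toAlgHom R R Q.ResidueField).comp σ' = φ := by
    apply P.hom_ext
    have h1 : P.equivRing P.x = P.X := by
      rw [StandardEtalePresentation.equivRing, AlgEquiv.symm_apply_eq]
      simp
    simp [σ', h1, haa', ha₀]
  refine ⟨σ'.comp (IsScalarTower.toAlgHom R R' _), fun z ↦ ?_⟩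
  have := congr($hσ' (algebraMap R' _ z))
  rw [hφ] at this
  simpa using this

theorem hens_factor {R : Type*} [CommRing R] [HenselianLocalRing R] (p : R[X]) (hp : p.Monic) :
    ∃ (F G : R[X]) (r : ℕ), p = F * G ∧ (∀ i, (F - X ^ r).coeff i ∈ maximalIdeal R) ∧
      G.coeff 0 ∉ maximalIdeal R := by
  let κ := (maximalIdeal R).ResidueField
  have hsurj : Function.Surjective (algebraMap R κ) := by
    intro z
    obtain ⟨y, rfl⟩ := (Ideal.bijective_algebraMap_quotient_residueField (maximalIdeal R)).2 z
    obtain ⟨y, rfl⟩ := Ideal.Quotient.mk_surjective y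
    exact ⟨y, rfl⟩
  have hmem : ∀ r : R, algebraMap R κ r = 0 ↔ r ∈ maximalIdeal R := fun r ↦
    Ideal.algebraMap_residueField_eq_zero
  let pb := p.map (algebraMap R κ)
  have hpb : pb.Monic := hp.map _
  obtain ⟨g, hg, hg0⟩ := Polynomial.exists_eq_pow_rootMultiplicity_mul_and_not_dvd pb hpb.ne_zero 0
  set r := pb.rootMultiplicity 0
  rw [map_zero, sub_zero] at hg hg0
  have hgm : g.Monic := (monic_X_pow r).of_mul_monic_left (hg ▸ hpb)
  have hcop : IsCoprime (X ^ r : κ[X]) g :=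
    IsCoprime.pow_left ((irreducible_X.coprime_iff_not_dvd).mpr hg0)
  obtain ⟨R', _, _, _, Q, _, _, f', g', hb, hf', hg', hfg, hc, h1, h2⟩ :=
    Algebra.exists_etale_bijective_residueFieldMap_and_map_eq_mul_and_isCoprime
    (maximalIdeal R) p (X ^ r) g hp (monic_X_pow r) hgm hg hcop
  have hs : Function.Surjective (algebraMap R Q.ResidueField) := by
    have := hb.2.comp hsurj
    convert this
    ext x
    simp only [Function.comp]
    exact (AlgHom.commutes (Ideal.ResidueField.mapₐ (maximalIdeal R) Q (Algebra.ofId _ _)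
      (Ideal.over_def Q _)) x).symm
  have hmem' : ∀ r : R, algebraMap R Q.ResidueField r = 0 ↔ r ∈ maximalIdeal R := by
    intro r
    rw [IsScalarTower.algebraMap_apply R R' Q.ResidueField, Ideal.algebraMap_residueField_eq_zero,
      Ideal.mem_of_liesOver Q (maximalIdeal R)]
  obtain ⟨σ, hσ⟩ := hens_section Q hs
  refine ⟨f'.map σ.toRingHom, g'.map σ.toRingHom, r, ?_, ?_, ?_⟩
  · rw [← Polynomial.map_mul, ← hfg, Polynomial.map_map]
    convert (Polynomial.map_id).symm
    ext; simp
  · intro i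
    rw [← hmem', coeff_sub, map_sub, coeff_map]
    have := congr(($h1).coeff i)
    simp only [Polynomial.map_pow, map_X, coeff_map] at this
    have h3 := hσ (f'.coeff i)
    simp only [AlgHom.toRingHom_eq_coe, RingHom.coe_coe, h3, ← this]
    simp only [coeff_X_pow]
    split_ifs <;> simp
  · rw [← hmem', coeff_map]
    have h3 := hσ (g'.coeff 0)
    have := congr(($h2).coeff 0)
    simp only [coeff_map] at this
    simp only [AlgHom.toRingHom_eq_coe, RingHom.coe_coe, h3, ← this]
    rw [map_eq_zero]
    rwa [X_dvd_iff] at hg0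

theorem hens_unique_prime {R D : Type*} [CommRing R] [HenselianLocalRing R] [CommRing D] [IsDomain D]
    [Algebra R D] [Algebra.IsIntegral R D] (M₁ M₂ : Ideal D) [M₁.IsPrime] [M₂.IsPrime]
    (h₁ : M₁.comap (algebraMap R D) = maximalIdeal R)
    (h₂ : M₂.comap (algebraMap R D) = maximalIdeal R) : M₁ ≤ M₂ := by
  intro a ha
  obtain ⟨p, hp, hpa⟩ := Algebra.IsIntegral.isIntegral (R := R) a
  obtain ⟨F, G, r, rfl, hF, hG⟩ := hens_factor p hp
  rw [← aeval_def, map_mul, mul_eq_zero] at hpa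
  have hGa : aeval a G ≠ 0 := by
    intro h0
    apply hG
    rw [← h₁, Ideal.mem_comap]
    have : aeval a G = a * aeval a G.divX + algebraMap R D (G.coeff 0) := by
      have := congr(aeval a $(divX_mul_X_add G))
      rw [map_add, map_mul, aeval_X, aeval_C] at this
      rw [← this]; ring
    rw [h0] at this
    have h3 : algebraMap R D (G.coeff 0) = - (a * aeval a G.divX) := by linear_combination -this
    rw [h3]
    exact M₁.neg_mem (M₁.mul_mem_right _ ha)
  have hFa := hpa.resolve_right hGa
  have : aeval a (F - X ^ r) ∈ M₂ := by
    rw [aeval_eq_sum_range]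
    refine M₂.sum_mem fun i _ ↦ ?_
    rw [Algebra.smul_def]
    refine M₂.mul_mem_right _ ?_
    have := hF i
    rwa [← h₂] at this
  rw [map_sub, hFa, zero_sub, map_pow, aeval_X, neg_mem_iff] at this
  exact Ideal.IsPrime.mem_of_pow_mem ‹_› _ this
end

section
open TensorProduct

/-- minimal primes of a flat algebra over a domain contract to zero. -/
theorem minimalPrimes_comap_bot {S A : Type*} [CommRing S] [IsDomain S] [CommRing A] [Algebra S A]
    [Module.Flat S A] (Q : Ideal A) (hQ : Q ∈ minimalPrimes A) : Q.comap (algebraMap S A) = ⊥ := by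
  have : Q.IsPrime := hQ.1.1
  have : Q.LiesOver (Q.comap (algebraMap S A)) := ⟨rfl⟩
  obtain ⟨P, hPQ, hP, hP'⟩ := Ideal.exists_ideal_le_liesOver_of_le (R := S) (p := ⊥)
    (q := Q.comap (algebraMap S A)) Q bot_le
  have h : P = Q := le_antisymm hPQ (hQ.2 ⟨hP, bot_le⟩ hPQ)
  rw [← h]
  exact (hP'.over).symm

theorem exists_idem_separating {S A : Type*} [CommRing S] [IsDomain S] [IsIntegrallyClosed S]
    [CommRing A] [Algebra S A] [Algebra.Etale S A] (Q₁ Q₂ : Ideal A)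
    (h₁ : Q₁ ∈ minimalPrimes A) (h₂ : Q₂ ∈ minimalPrimes A) (hne : Q₁ ≠ Q₂) :
    ∃ e : A, IsIdempotentElem e ∧ e ∈ Q₁ ∧ 1 - e ∈ Q₂ := by
  let F := FractionRing S
  have : Q₁.IsPrime := h₁.1.1
  have : Q₂.IsPrime := h₂.1.1
  have : Module.Flat S A := inferInstance
  let E := A ⊗[S] F
  have : Module.Finite F (F ⊗[S] A) := Algebra.FormallyUnramified.finite_of_free F _
  have : IsArtinianRing (F ⊗[S] A) := IsArtinianRing.of_finite F _
  have : IsArtinianRing E :=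
    Function.Surjective.isArtinianRing (f := Algebra.TensorProduct.comm S F A)
      (AlgEquiv.surjective _)
  have hloc : IsLocalization (Algebra.algebraMapSubmonoid A (nonZeroDivisors S)) E :=
    inferInstance
  have hdis : ∀ Q ∈ minimalPrimes A, Disjoint
      (Algebra.algebraMapSubmonoid A (nonZeroDivisors S) : Set A) (Q : Set A) := by
    intro Q hQ
    rw [Set.disjoint_left]
    rintro _ ⟨s, hs, rfl⟩ hsQ
    have : s ∈ Q.comap (algebraMap S A) := hsQ
    rw [minimalPrimes_comap_bot Q hQ, Ideal.mem_bot] at this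
    exact nonZeroDivisors.ne_zero hs this
  have hp : ∀ Q ∈ minimalPrimes A, (Q.map (algebraMap A E)).IsPrime := fun Q hQ ↦
    have := hQ.1.1
    IsLocalization.isPrime_of_isPrime_disjoint (Algebra.algebraMapSubmonoid A (nonZeroDivisors S)) E
      Q this (hdis Q hQ)
  have hc : ∀ Q ∈ minimalPrimes A, (Q.map (algebraMap A E)).comap (algebraMap A E) = Q := fun Q hQ ↦
    have := hQ.1.1
    IsLocalization.under_map_of_isPrime_disjoint
      (Algebra.algebraMapSubmonoid A (nonZeroDivisors S)) E this (hdis Q hQ)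
  let q₁ : PrimeSpectrum E := ⟨_, hp _ h₁⟩
  let q₂ : PrimeSpectrum E := ⟨_, hp _ h₂⟩
  have hqne : q₁ ≠ q₂ := by
    intro h
    apply hne
    rw [← hc _ h₁, ← hc _ h₂]
    exact congr(($h).asIdeal.comap (algebraMap A E))
  let e' := PrimeSpectrum.isIdempotentElemEquivClopens.symm
    (⟨{q₂}, isClopen_discrete _⟩ : TopologicalSpace.Clopens (PrimeSpectrum E))
  have hb := PrimeSpectrum.basicOpen_isIdempotentElemEquivClopens_symm
    (⟨{q₂}, isClopen_discrete _⟩ : TopologicalSpace.Clopens (PrimeSpectrum E))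
  have he1 : e'.1 ∈ q₁.asIdeal := by
    have : q₁ ∉ PrimeSpectrum.basicOpen e'.1 := by
      rw [hb]; exact hqne
    simpa using this
  have he2 : e'.1 ∉ q₂.asIdeal := by
    have : q₂ ∈ PrimeSpectrum.basicOpen e'.1 := by
      rw [hb]; rfl
    simpa using this
  have hid : e'.1 * e'.1 = e'.1 := e'.2
  have hintg : IsIntegral A e'.1 := ⟨Polynomial.X ^ 2 - Polynomial.X, by monicity!, by
    simp [pow_two, hid]⟩
  obtain ⟨y, hy⟩ := (TensorProduct.toIntegralClosure_bijective_of_smooth (R := S) (S := A) (B := F)).2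
    ⟨e'.1, hintg⟩
  have hy' : ∃ e : A, algebraMap A E e = e'.1 := by
    have hy2 : (Algebra.TensorProduct.map (.id A A) (integralClosure S F).val) y = e'.1 :=
      congr(($hy).1)
    rw [← hy2]
    clear hy hy2
    induction y with
    | zero => exact ⟨0, by simp⟩
    | add x y hx hy =>
      obtain ⟨a, ha⟩ := hx
      obtain ⟨b, hb⟩ := hy
      exact ⟨a + b, by rw [map_add, map_add, ha, hb]⟩
    | tmul x z =>
      obtain ⟨s, hs⟩ := IsIntegrallyClosed.isIntegral_iff.mp z.2
      refine ⟨s • x, ?_⟩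
      simp only [Algebra.TensorProduct.map_tmul, AlgHom.coe_id, id_eq, Subalgebra.coe_val, ← hs]
      change (s • x) ⊗ₜ[S] (1 : F) = _
      rw [TensorProduct.smul_tmul, Algebra.smul_def, mul_one]
  obtain ⟨e, he⟩ := hy'
  have hinj : Function.Injective (algebraMap A E) := 
    Algebra.TensorProduct.includeLeft_injective (S := A) (FaithfulSMul.algebraMap_injective S F)
  refine ⟨e, hinj (by rw [map_mul, he, hid]), ?_, ?_⟩
  · rw [← hc _ h₁, Ideal.mem_comap, he]; exact he1
  · rw [← hc _ h₂, Ideal.mem_comap, map_sub, he, map_one]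
    exact (q₂.2.mem_or_mem (show e'.1 * (1 - e'.1) ∈ q₂.asIdeal by
      rw [mul_sub, mul_one, hid, sub_self]; exact zero_mem _)).resolve_left he2
end

section
open TensorProduct IsLocalRing

theorem exists_pow_sub_mem_of_sepClosed {R D : Type*} [CommRing R] [IsLocalRing R]
    [IsSepClosed (ResidueField R)] [CommRing D] [Algebra R D] [Algebra.IsIntegral R D]
    (M : Ideal D) [M.IsPrime] (hM : M.comap (algebraMap R D) = maximalIdeal R) (a : D) :
    ∃ (n : ℕ) (r : R), a ^ (ringExpChar (ResidueField R)) ^ n - algebraMap R D r ∈ M := by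
  have : M.LiesOver (maximalIdeal R) := ⟨hM.symm⟩
  have hmax : M.IsMaximal := Ideal.isMaximal_of_isIntegral_of_isMaximal_comap (R := R) M
    (by rw [hM]; infer_instance)
  let : Field (D ⧸ M) := Ideal.Quotient.field M
  let : Algebra (ResidueField R) (D ⧸ M) :=
    inferInstanceAs (Algebra (R ⧸ maximalIdeal R) (D ⧸ M))
  have : IsScalarTower R (ResidueField R) (D ⧸ M) :=
    inferInstanceAs (IsScalarTower R (R ⧸ maximalIdeal R) (D ⧸ M))
  have : Algebra.IsIntegral R (D ⧸ M) :=
    Algebra.IsIntegral.trans D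
  have : Algebra.IsIntegral (ResidueField R) (D ⧸ M) := Algebra.IsIntegral.tower_top R
  have : Algebra.IsAlgebraic (ResidueField R) (D ⧸ M) := inferInstance
  have : IsPurelyInseparable (ResidueField R) (D ⧸ M) := inferInstance
  obtain ⟨n, y, hy⟩ := IsPurelyInseparable.pow_mem (ResidueField R) (ringExpChar (ResidueField R))
    (Ideal.Quotient.mk M a)
  obtain ⟨r, rfl⟩ := IsLocalRing.residue_surjective y
  refine ⟨n, r, ?_⟩
  rw [← Ideal.Quotient.eq_zero_iff_mem, map_sub, map_pow, ← hy, sub_eq_zero]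
  rfl

theorem radicial_key {R B C : Type*} [CommRing R] [CommRing B] [CommRing C] [Algebra R B]
    [Algebra R C] (J : Ideal (B ⊗[R] C)) (q : ℕ) [ExpChar (B ⊗[R] C ⧸ J) q]
    (hC : ∀ a : C, ∃ (n : ℕ) (r : R), (1 : B) ⊗ₜ[R] (a ^ q ^ n - algebraMap R C r) ∈ J)
    (z : B ⊗[R] C) : ∃ (n : ℕ) (b : B), z ^ q ^ n - algebraMap B (B ⊗[R] C) b ∈ J := by
  suffices ∃ (n : ℕ) (b : B), Ideal.Quotient.mk J z ^ q ^ n =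
      Ideal.Quotient.mk J (algebraMap B (B ⊗[R] C) b) by
    obtain ⟨n, b, h⟩ := this
    exact ⟨n, b, by rwa [← Ideal.Quotient.eq, map_pow]⟩
  induction z with
  | zero => exact ⟨0, 0, by simp⟩
  | tmul x a =>
    obtain ⟨n, r, hr⟩ := hC a
    refine ⟨n, x ^ q ^ n * algebraMap R B r, ?_⟩
    have h4 : (x ⊗ₜ[R] a : B ⊗[R] C) = algebraMap B _ x * (1 ⊗ₜ a) := by
      simp
    have h5 : Ideal.Quotient.mk J ((1 : B) ⊗ₜ a) ^ q ^ n =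
        Ideal.Quotient.mk J (algebraMap R (B ⊗[R] C) r) := by
      rw [← map_pow, Ideal.Quotient.eq]
      convert hr
      rw [tmul_sub, Algebra.TensorProduct.tmul_pow, one_pow,
        Algebra.TensorProduct.algebraMap_apply, Algebra.algebraMap_eq_smul_one,
        Algebra.algebraMap_eq_smul_one, smul_tmul]
    rw [h4, map_mul, mul_pow, h5, map_mul, map_mul, map_pow, map_pow,
        ← IsScalarTower.algebraMap_apply]
  | add z w hz hw =>
    obtain ⟨n, b, hb⟩ := hz
    obtain ⟨m, c, hc⟩ := hw
    refine ⟨n + m, b ^ q ^ m + c ^ q ^ n, ?_⟩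
    rw [map_add, add_pow_expChar_pow, pow_add, pow_mul, hb, mul_comm, pow_mul, hc]
    simp only [map_add, map_pow]

theorem no_idem_separating {R B L : Type*} [CommRing R] [HenselianLocalRing R]
    [IsSepClosed (ResidueField R)] [CommRing B] [Algebra R B] [Algebra.Smooth R B]
    [Field L] [Algebra R L] 
    (p : Ideal B) [p.IsPrime] (hp : p.comap (algebraMap R B) = maximalIdeal R)
    (Q₁ Q₂ : Ideal (B ⊗[R] L)) [Q₁.IsPrime] [Q₂.IsPrime]
    (h₁ : Q₁.comap (algebraMap B (B ⊗[R] L)) ≤ p) (h₂ : Q₂.comap (algebraMap B (B ⊗[R] L)) ≤ p)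
    (e : B ⊗[R] L) (he : IsIdempotentElem e) (he₁ : e ∈ Q₁) (he₂ : 1 - e ∈ Q₂) : False := by
  let RL := integralClosure R L
  let D := B ⊗[R] RL
  let j : D →ₐ[B] B ⊗[R] L := Algebra.TensorProduct.map (.id B B) (integralClosure R L).val
  have hintg : IsIntegral B e := ⟨Polynomial.X ^ 2 - Polynomial.X, by monicity!, by
    simp [pow_two, he.eq]⟩
  obtain ⟨e₀, he₀⟩ := (TensorProduct.toIntegralClosure_bijective_of_smooth
    (R := R) (S := B) (B := L)).2 ⟨e, hintg⟩
  replace he₀ : j e₀ = e := congr(($he₀).1)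
  have hgo : ∀ (Q : Ideal (B ⊗[R] L)) [Q.IsPrime], Q.comap (algebraMap B (B ⊗[R] L)) ≤ p →
      ∃ P : Ideal D, P.IsPrime ∧ Q.comap j.toRingHom ≤ P ∧ P.comap (algebraMap B D) = p := by
    intro Q _ h
    obtain ⟨P, hP1, hP2, hP3⟩ := Ideal.exists_ideal_over_prime_of_isIntegral p (Q.comap j.toRingHom) (by
      rw [Ideal.comap_comap]
      convert h
      exact j.comp_algebraMap)
    exact ⟨P, hP2, hP1, hP3⟩
  obtain ⟨P₁, _, hQP₁, hP₁⟩ := hgo Q₁ h₁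
  obtain ⟨P₂, _, hQP₂, hP₂⟩ := hgo Q₂ h₂
  have he₁' : e₀ ∈ P₁ := hQP₁ (by rw [Ideal.mem_comap]; change j e₀ ∈ _; rwa [he₀])
  have he₂' : 1 - e₀ ∈ P₂ := hQP₂ (by rw [Ideal.mem_comap]; change j (1 - e₀) ∈ _; rwa [map_sub, he₀, map_one])
  let i : RL →ₐ[R] D := Algebra.TensorProduct.includeRight
  have hcomp : ∀ (P : Ideal D), P.comap (algebraMap B D) = p →
      (P.comap i.toRingHom).comap (algebraMap R RL) = maximalIdeal R := by
    intro P hP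
    rw [← hp, ← hP, Ideal.comap_comap, Ideal.comap_comap, ← IsScalarTower.algebraMap_eq]
    congr 1
    exact i.comp_algebraMap
  have hM : P₁.comap i.toRingHom = P₂.comap i.toRingHom := le_antisymm
    (hens_unique_prime (R := R) _ _ (hcomp _ hP₁) (hcomp _ hP₂))
    (hens_unique_prime (R := R) _ _ (hcomp _ hP₂) (hcomp _ hP₁))
  let q := ringExpChar (ResidueField R)
  let J := P₁ ⊓ P₂
  have hJ : J ≠ ⊤ := fun h ↦ Ideal.IsPrime.ne_top' (I := P₁) (top_le_iff.mp (h ▸ inf_le_left))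
  have : Nontrivial (D ⧸ J) := Ideal.Quotient.nontrivial_iff.mpr hJ
  let φ : ResidueField R →+* D ⧸ J := Ideal.Quotient.lift (maximalIdeal R) (algebraMap R (D ⧸ J)) (by
    intro a ha
    rw [IsScalarTower.algebraMap_apply R D (D ⧸ J), Ideal.Quotient.algebraMap_eq,
      Ideal.Quotient.eq_zero_iff_mem]
    rw [← hp] at ha
    rw [IsScalarTower.algebraMap_apply R B D]
    constructor
    · have : algebraMap R B a ∈ P₁.comap (algebraMap B D) := hP₁ ▸ ha
      exact this
    · have : algebraMap R B a ∈ P₂.comap (algebraMap B D) := hP₂ ▸ ha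
      exact this)
  have hexp : ExpChar (D ⧸ J) q := expChar_of_injective_ringHom φ.injective q
  have key : ∀ z : D, ∃ (n : ℕ) (b : B), z ^ q ^ n - algebraMap B D b ∈ J := by
    apply radicial_key (R := R) (B := B) (C := RL) J q
    intro a
    obtain ⟨n, r, hr⟩ := exists_pow_sub_mem_of_sepClosed (P₁.comap i.toRingHom) (hcomp _ hP₁) a
    exact ⟨n, r, hr, by rw [hM] at hr; exact hr⟩
  obtain ⟨n, b, hb⟩ := key e₀
  have hq : q ^ n ≠ 0 := pow_ne_zero _ (expChar_pos (D ⧸ J) q).ne'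
  have hb1 : algebraMap B D b ∈ P₁ := by
    have := P₁.sub_mem (Ideal.pow_mem_of_mem P₁ he₁' (q ^ n) (Nat.pos_of_ne_zero hq)) hb.1
    rwa [sub_sub_cancel] at this
  have hb2 : algebraMap B D b ∈ P₂ := by
    have : b ∈ P₁.comap (algebraMap B D) := hb1
    rw [hP₁, ← hP₂] at this
    exact this
  have : e₀ ^ q ^ n ∈ P₂ := by
    have := P₂.add_mem hb.2 hb2
    rwa [sub_add_cancel] at this
  have h6 := P₂.add_mem (Ideal.IsPrime.mem_of_pow_mem ‹_› _ this) he₂'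
  rw [add_sub_cancel] at h6
  exact Ideal.IsPrime.ne_top' (I := P₂) ((Ideal.eq_top_iff_one _).mpr h6)
end

section
open TensorProduct IsLocalRing

theorem minimalPrimes_transfer {A A' : Type*} [CommRing A] [CommRing A'] [Algebra A A'] (g : A)
    [IsLocalization.Away g A'] (Q : Ideal A) (hQ : Q ∈ minimalPrimes A) (hg : g ∉ Q) :
    Q.map (algebraMap A A') ∈ minimalPrimes A' ∧
      (Q.map (algebraMap A A')).comap (algebraMap A A') = Q := by
  have := hQ.1.1
  have hd : Disjoint (Submonoid.powers g : Set A) (Q : Set A) :=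
    (Ideal.disjoint_powers_iff_notMem_of_isPrime _).mpr hg
  have hc := IsLocalization.under_map_of_isPrime_disjoint (Submonoid.powers g) A' this hd
  have hp := IsLocalization.isPrime_of_isPrime_disjoint (Submonoid.powers g) A' Q this hd
  refine ⟨⟨⟨hp, bot_le⟩, ?_⟩, hc⟩
  intro P hP hPQ
  have h1 : P.comap (algebraMap A A') ≤ Q := by
    rw [← hc]; exact Ideal.comap_mono hPQ
  have := hP.1
  have h2 := hQ.2 ⟨inferInstance, bot_le⟩ h1
  exact Ideal.map_le_iff_le_comap.mpr h2

theorem minimalPrimes_comap_equiv {A A' : Type*} [CommRing A] [CommRing A'] (φ : A' ≃+* A)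
    (Q : Ideal A) (hQ : Q ∈ minimalPrimes A) : Q.comap φ.toRingHom ∈ minimalPrimes A' := by
  have := hQ.1.1
  refine ⟨⟨inferInstance, bot_le⟩, ?_⟩
  intro P hP hPQ
  have := hP.1
  have h1 : P.comap φ.symm.toRingHom ≤ Q := by
    intro x hx
    have : φ (φ.symm x) ∈ Q := hPQ hx
    simpa using this
  have h2 := hQ.2 ⟨inferInstance, bot_le⟩ h1
  intro x hx
  have : φ.symm (φ x) ∈ P := h2 hx
  simpa using this

attribute [local instance] MvPolynomial.algebraMvPolynomial in
theorem exists_idem_separating_smooth {R C L : Type*} [CommRing R] [CommRing C] [Algebra R C]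
    [Field L] [Algebra R L] (n : ℕ) [Algebra (MvPolynomial (Fin n) R) C]
    [IsScalarTower R (MvPolynomial (Fin n) R) C] [Algebra.Etale (MvPolynomial (Fin n) R) C]
    (Q₁ Q₂ : Ideal (C ⊗[R] L)) (hQ₁ : Q₁ ∈ minimalPrimes (C ⊗[R] L))
    (hQ₂ : Q₂ ∈ minimalPrimes (C ⊗[R] L)) (hne : Q₁ ≠ Q₂) :
    ∃ e : C ⊗[R] L, IsIdempotentElem e ∧ e ∈ Q₁ ∧ 1 - e ∈ Q₂ := by
  let φ₁ := Algebra.IsPushout.equiv R (MvPolynomial (Fin n) R) L (MvPolynomial (Fin n) L)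
  let φ₂ := Algebra.TensorProduct.congr (AlgEquiv.refl (R := MvPolynomial (Fin n) R) (A₁ := C)) φ₁
  let φ₃ := Algebra.TensorProduct.cancelBaseChange R (MvPolynomial (Fin n) R)
    (MvPolynomial (Fin n) R) C L
  let φ₄ := Algebra.TensorProduct.comm (MvPolynomial (Fin n) R) (MvPolynomial (Fin n) L) C
  let φ : MvPolynomial (Fin n) L ⊗[MvPolynomial (Fin n) R] C ≃+* C ⊗[R] L :=
    ((φ₄.trans φ₂.symm).trans φ₃).toRingEquiv
  obtain ⟨e, he, he₁, he₂⟩ := exists_idem_separating (S := MvPolynomial (Fin n) L)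
    _ _ (minimalPrimes_comap_equiv φ _ hQ₁)
    (minimalPrimes_comap_equiv φ _ hQ₂) (by
      intro h
      exact hne (Ideal.comap_injective_of_surjective φ.toRingHom φ.surjective h))
  refine ⟨φ e, he.map φ, he₁, ?_⟩
  have : φ (1 - e) ∈ Q₂ := he₂
  simpa using this

theorem minimalPrimes_unique {R B L : Type*} [CommRing R] [HenselianLocalRing R]
    [IsSepClosed (ResidueField R)] [CommRing B] [Algebra R B] [Algebra.Smooth R B]
    [Field L] [Algebra R L]
    (p : Ideal B) [p.IsPrime] (hp : p.comap (algebraMap R B) = maximalIdeal R)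
    (Q₁ Q₂ : Ideal (B ⊗[R] L)) (hQ₁ : Q₁ ∈ minimalPrimes (B ⊗[R] L))
    (hQ₂ : Q₂ ∈ minimalPrimes (B ⊗[R] L))
    (h₁ : Q₁.comap (algebraMap B (B ⊗[R] L)) ≤ p) (h₂ : Q₂.comap (algebraMap B (B ⊗[R] L)) ≤ p) :
    Q₁ = Q₂ := by
  obtain ⟨f, hf, n, _, _, _⟩ :=
    Algebra.IsSmoothAt.exists_isStandardEtale_mvPolynomial (R := R) (p := p)
  let Bf := Localization.Away f
  let i : B ⊗[R] L →+* Localization.Away f ⊗[R] L :=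
    (Algebra.TensorProduct.map (Algebra.ofId B (Localization.Away f)) (.id R L)).toRingHom
  let _ : Algebra (B ⊗[R] L) (Localization.Away f ⊗[R] L) := i.toAlgebra
  have htow : IsScalarTower B (B ⊗[R] L) (Localization.Away f ⊗[R] L) :=
    .of_algebraMap_eq fun x ↦ by
      change _ = i (x ⊗ₜ 1)
      simp only [i, AlgHom.toRingHom_eq_coe, RingHom.coe_coe, Algebra.TensorProduct.map_tmul, map_one]
      rfl
  have hloc : IsLocalization (Algebra.algebraMapSubmonoid (B ⊗[R] L) (.powers f))
     (Localization.Away f ⊗[R] L) :=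
    IsLocalization.tensorProduct_tensorProduct R L (.powers f) (Localization.Away f) (by
      ext x
      change i (1 ⊗ₜ x) = 1 ⊗ₜ x
      simp [i])
  have hloc' : IsLocalization.Away (algebraMap B (B ⊗[R] L) f) (Localization.Away f ⊗[R] L) := by
    simpa using hloc
  have ht := fun Q hQ h ↦ minimalPrimes_transfer (A := B ⊗[R] L) (A' := Localization.Away f ⊗[R] L)
    (algebraMap B (B ⊗[R] L) f) Q hQ (h : algebraMap B (B ⊗[R] L) f ∉ Q)
  have hf₁ : algebraMap B (B ⊗[R] L) f ∉ Q₁ := fun h ↦ hf (h₁ h)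
  have hf₂ : algebraMap B (B ⊗[R] L) f ∉ Q₂ := fun h ↦ hf (h₂ h)
  by_contra hne
  obtain ⟨e, he, he₁, he₂⟩ := exists_idem_separating_smooth (R := R) n _ _ (ht Q₁ hQ₁ hf₁).1
    (ht Q₂ hQ₂ hf₂).1 (by
      intro h
      apply hne
      rw [← (ht Q₁ hQ₁ hf₁).2, h, (ht Q₂ hQ₂ hf₂).2])
  have : (Q₁.map (algebraMap (B ⊗[R] L) (Localization.Away f ⊗[R] L))).IsPrime :=
    (ht Q₁ hQ₁ hf₁).1.1.1
  have : (Q₂.map (algebraMap (B ⊗[R] L) (Localization.Away f ⊗[R] L))).IsPrime :=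
    (ht Q₂ hQ₂ hf₂).1.1.1
  have hd : Disjoint (Submonoid.powers f : Set B) (p : Set B) :=
    (Ideal.disjoint_powers_iff_notMem_of_isPrime _).mpr hf
  have hp' := IsLocalization.isPrime_of_isPrime_disjoint (Submonoid.powers f)
    (Localization.Away f) p inferInstance hd
  have hcp := IsLocalization.under_map_of_isPrime_disjoint (Submonoid.powers f)
    (Localization.Away f) (I := p) inferInstance hd
  have hcc : ∀ Q ∈ minimalPrimes (B ⊗[R] L), Q.comap (algebraMap B (B ⊗[R] L)) ≤ p →
     algebraMap B (B ⊗[R] L) f ∉ Q →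
     (Q.map (algebraMap (B ⊗[R] L) (Localization.Away f ⊗[R] L))).comap
      (algebraMap (Localization.Away f) (Localization.Away f ⊗[R] L)) ≤
      p.map (algebraMap B (Localization.Away f)) := by
    intro Q hQ h hfQ
    rw [← IsLocalization.map_under (Submonoid.powers f) (Localization.Away f)
      (Ideal.comap _ _)]
    apply Ideal.map_mono
    refine le_trans (le_of_eq ?_) h
    conv_rhs => rw [← (ht Q hQ hfQ).2]
    rw [Ideal.under_def, Ideal.comap_comap, Ideal.comap_comap, ← IsScalarTower.algebraMap_eq,
      ← IsScalarTower.algebraMap_eq]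
  have : Algebra.Smooth R (Localization.Away f) := 
    have : Algebra.Smooth B (Localization.Away f) := inferInstance
    Algebra.Smooth.comp R B _
  exact no_idem_separating (R := R) (L := L) (p.map (algebraMap B (Localization.Away f)))
    (by
      rw [Ideal.under_def] at hcp
      conv_rhs => rw [← hp, ← hcp]
      rw [Ideal.comap_comap, ← IsScalarTower.algebraMap_eq])
    _ _ (hcc Q₁ hQ₁ h₁ hf₁) (hcc Q₂ hQ₂ h₂ hf₂) e he he₁ he₂
end

section
open TensorProduct Polynomial

theorem std_etale_lift_aux {P A C : Type*} [CommRing P] [CommRing A] [Nontrivial A] [CommRing C] [Algebra P A]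
    [Algebra A C] (hs : Function.Surjective (algebraMap P A))
    (E : StandardEtalePresentation A C) :
    ∃ E' : StandardEtalePair P, Nonempty (A ⊗[P] E'.Ring ≃ₐ[A] C) := by
  algebraize [(algebraMap A C).comp (algebraMap P A)]
  obtain ⟨f, hf, -, hfm⟩ := Polynomial.lifts_and_degree_eq_and_monic
    (f := algebraMap P A) (p := E.f) ((Polynomial.mem_lifts _).2 (Polynomial.map_surjective _ hs _)) E.monic_f
  obtain ⟨g, hg⟩ := Polynomial.map_surjective _ hs E.g
  let E' : StandardEtalePair P := ⟨f, hfm, g * derivative f, g, 0, 1, by ring⟩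
  have h1 : E'.HasMap E.x := by
    constructor
    · have := E.hasMap.1
      rw [← hf] at this
      simpa using this
    · have h1 := E.hasMap.2
      have h2 := E.hasMap.isUnit_derivative_f
      rw [← hg] at h1
      rw [← hf] at h2
      simp only [Polynomial.derivative_map] at h2
      simp only [Polynomial.aeval_map_algebraMap] at h1 h2
      simp only [E', map_mul]
      exact h1.mul h2
  have h2 : E.P.HasMap (1 ⊗ₜ[P] E'.X : A ⊗[P] E'.Ring) := by
    have h0 := E'.hasMap_X.map (Algebra.TensorProduct.includeRight (R := P) (A := A))
    constructor
    · rw [← hf]; simpa using h0.1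
    · rw [← hg]
      have := h0.2
      simp only [E', map_mul] at this
      simpa using isUnit_of_mul_isUnit_left this
  refine ⟨E', ⟨.ofAlgHom (Algebra.TensorProduct.lift (Algebra.ofId _ _) (E'.lift E.x h1)
        fun _ _ ↦ .all _ _) ((E.P.lift _ h2).comp E.equivRing.toAlgHom) ?_ ?_⟩⟩
  · apply E.hom_ext
    simp
  · ext1
    apply E'.hom_ext
    simp

theorem std_etale_lift {P A C : Type*} [CommRing P] [CommRing A] [Nontrivial A] [CommRing C] [Algebra P A]
    [Algebra A C] [Algebra P C] [IsScalarTower P A C] (hs : Function.Surjective (algebraMap P A))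
    (E : StandardEtalePresentation A C) :
    ∃ (E' : StandardEtalePair P) (φ : E'.Ring →ₐ[P] C), Function.Surjective φ ∧
      ∀ x, φ x = 0 → (x ⊗ₜ[P] (1:A) = 0) := by
  obtain ⟨E', ⟨e⟩⟩ := std_etale_lift_aux hs E
  refine ⟨E', ((e.restrictScalars P).toAlgHom.comp
    (Algebra.TensorProduct.includeRight (R := P) (A := A))), ?_, ?_⟩
  · intro c
    obtain ⟨t, rfl⟩ := e.surjective c
    obtain ⟨x, rfl⟩ : ∃ x, (1:A) ⊗ₜ[P] x = t := by
      induction t with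
      | zero => exact ⟨0, by simp⟩
      | add x y hx hy =>
        obtain ⟨x, rfl⟩ := hx
        obtain ⟨y, rfl⟩ := hy
        exact ⟨x + y, by simp [tmul_add]⟩
      | tmul a x =>
        obtain ⟨a, rfl⟩ := hs a
        exact ⟨a • x, by rw [Algebra.algebraMap_eq_smul_one, smul_tmul]⟩
    exact ⟨x, rfl⟩
  · intro x hx
    have : (1:A) ⊗ₜ[P] x = 0 := e.injective (by rw [map_zero]; exact hx)
    have h2 := congrArg (TensorProduct.comm P _ _) this
    simpa using h2
end

section
open TensorProduct Polynomial Algebra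

set_option maxHeartbeats 1000000 in
theorem h1_std_etale {K A C : Type*} [CommRing K] [CommRing A] [Nontrivial A] [CommRing C]
    [Algebra K A] [Algebra A C] [Algebra K C] [IsScalarTower K A C]
    (E : StandardEtalePresentation A C) :
    Nonempty (C ⊗[A] H1Cotangent K A ≃ₗ[C] H1Cotangent K C) := by
  let P : Extension K A := (Generators.self K A).toExtension
  have : FormallySmooth K P.Ring := (show FormallySmooth K (MvPolynomial A K) from inferInstance)
  let aPC := ((algebraMap A C).comp (algebraMap P.Ring A)).toAlgebra
  have : IsScalarTower P.Ring A C := .of_algebraMap_eq' rfl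
  obtain ⟨E', φ, hφ, hk⟩ := std_etale_lift (P := P.Ring) (A := A) (C := C) P.algebraMap_surjective E
  let aKE : Algebra K E'.Ring := ((algebraMap P.Ring E'.Ring).comp (algebraMap K P.Ring)).toAlgebra
  have : IsScalarTower K P.Ring E'.Ring := .of_algebraMap_eq' rfl
  have : IsScalarTower K P.Ring C := .of_algebraMap_eq fun x => by
    rw [IsScalarTower.algebraMap_apply P.Ring A C, ← IsScalarTower.algebraMap_apply K P.Ring A,
      ← IsScalarTower.algebraMap_apply]
  let fQ : E'.Ring →ₐ[K] C := φ.restrictScalars K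
  let Q : Extension K C := .ofSurjective fQ hφ
  let f : P.Hom Q :=
  { toRingHom := algebraMap P.Ring E'.Ring
    toRingHom_algebraMap x := (IsScalarTower.algebraMap_apply K P.Ring E'.Ring _).symm
    algebraMap_toRingHom x := φ.commutes x }
  have : Algebra.Etale P.Ring E'.Ring := inferInstance
  have : FormallySmooth K Q.Ring := FormallySmooth.comp K P.Ring E'.Ring
  have : Algebra.Etale A C := by
    have : IsStandardEtale A C := ⟨⟨E⟩⟩
    infer_instance
  have : Module.Flat A C := inferInstance
  let : Algebra P.Ring Q.Ring := (inferInstance : Algebra P.Ring E'.Ring)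
  refine ⟨Extension.tensorH1CotangentOfFormallyEtale f rfl ?_ ?_ ≪≫ₗ
      Extension.equivH1CotangentOfFormallySmooth _⟩
  · exact RingHom.formallyEtale_algebraMap.mpr (inferInstanceAs (FormallyEtale P.Ring E'.Ring))
  · let F : P.ker →ₗ[P.Ring] RingHom.ker fQ := f.mapKer rfl
    change Function.Bijective (F.liftBaseChange E'.Ring)
    have key : ∀ t : E'.Ring ⊗[P.Ring] P.ker, ((F.liftBaseChange E'.Ring) t : E'.Ring) =
        (TensorProduct.rid P.Ring E'.Ring) (LinearMap.lTensor E'.Ring P.ker.subtype t) := by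
      intro t
      induction t with
      | zero => simp
      | add x y hx hy => simp only [map_add, ← hx, ← hy]; rfl
      | tmul a x =>
        simp only [LinearMap.liftBaseChange_tmul, LinearMap.lTensor_tmul, Submodule.subtype_apply,
          rid_tmul]
        rw [Algebra.smul_def, mul_comm]
        rfl
    constructor
    · intro s t hst
      have h := congrArg Subtype.val hst
      rw [key, key] at h
      exact Module.Flat.lTensor_preserves_injective_linearMap _ P.ker.injective_subtype
        ((TensorProduct.rid P.Ring E'.Ring).injective h)
    · intro x
      have hx := hk x.1 x.2
      have hex : Function.Exact P.ker.subtype (Algebra.linearMap P.Ring A) := by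
        intro y
        simp [Extension.ker, RingHom.mem_ker]
      have := (Module.Flat.lTensor_exact E'.Ring hex (x.1 ⊗ₜ 1)).1 (by simpa using hx)
      obtain ⟨t, ht⟩ := this
      refine ⟨t, Subtype.ext ?_⟩
      rw [key, ht]
      simp
end

section
open TensorProduct Polynomial Algebra

theorem smoothAt_descent_std {K A C : Type*} [CommRing K] [CommRing A] [CommRing C]
    [Algebra K A] [Algebra A C] [Algebra K C] [IsScalarTower K A C]
    [Algebra.FiniteType K A] [Algebra.IsStandardEtale A C] (p : Ideal A) [p.IsPrime]
    (q : Ideal C) [q.IsPrime] [q.LiesOver p]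
    (h : Algebra.IsSmoothAt K q) : Algebra.IsSmoothAt K p := by
  have : Nontrivial A := ⟨0, 1, fun h => (Ideal.ne_top_iff_one p).1 (inferInstance : p.IsPrime).ne_top
    (h ▸ p.zero_mem)⟩
  obtain ⟨E⟩ := Algebra.IsStandardEtale.nonempty_standardEtalePresentation (R := A) (S := C)
  obtain ⟨e⟩ := h1_std_etale (K := K) E
  let := Localization.AtPrime.algebraOfLiesOver p q
  have hfl : Module.Flat (Localization.AtPrime p) (Localization.AtPrime q) := inferInstance
  have : IsScalarTower A (Localization.AtPrime p) (Localization.AtPrime q) := inferInstance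
  have : IsScalarTower K (Localization.AtPrime p) (Localization.AtPrime q) :=
    .of_algebraMap_eq fun x => by
      rw [IsScalarTower.algebraMap_apply K A (Localization.AtPrime p),
        ← IsScalarTower.algebraMap_apply A (Localization.AtPrime p),
        ← IsScalarTower.algebraMap_apply K A]
  have hloc : IsLocalHom (algebraMap (Localization.AtPrime p) (Localization.AtPrime q)) := inferInstance
  have hff : Module.FaithfullyFlat (Localization.AtPrime p) (Localization.AtPrime q) :=
    Module.FaithfullyFlat.of_flat_of_isLocalHom
  have h : FormallySmooth K (Localization.AtPrime q) := h
  have : FormallyEtale C (Localization.AtPrime q) := .of_isLocalization q.primeCompl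
  have : FormallyEtale A (Localization.AtPrime p) := .of_isLocalization p.primeCompl
  have : FormallyEtale A (Localization.AtPrime q) := .comp A C _
  have : FormallyEtale (Localization.AtPrime p) (Localization.AtPrime q) :=
    .of_restrictScalars (R := A)
  refine ⟨?_, ?_⟩
  · let e1 := KaehlerDifferential.tensorKaehlerEquivOfFormallyEtale K (Localization.AtPrime p)
      (Localization.AtPrime q)
    have : Module.Flat (Localization.AtPrime q)
      (Localization.AtPrime q ⊗[Localization.AtPrime p] Ω[Localization.AtPrime p⁄K]) :=
      Module.Flat.of_linearEquiv e1
    have : Module.Flat (Localization.AtPrime p) Ω[Localization.AtPrime p⁄K] :=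
      Module.Flat.of_flat_tensorProduct _ _ (Localization.AtPrime q)
    have : Algebra.EssFiniteType K (Localization.AtPrime p) := .comp K A _
    have : Module.Finite (Localization.AtPrime p) Ω[Localization.AtPrime p⁄K] := inferInstance
    have := Module.free_of_flat_of_isLocalRing (R := (Localization.AtPrime p))
      (P := Ω[Localization.AtPrime p⁄K])
    infer_instance
  · let e1 := tensorH1CotangentOfIsLocalization K (S := A) (T := Localization.AtPrime p) p.primeCompl
    let e2 := tensorH1CotangentOfIsLocalization K (S := C) (T := Localization.AtPrime q) q.primeCompl
    have h0 : Subsingleton (Localization.AtPrime q ⊗[C] H1Cotangent K C) :=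
      e2.toEquiv.subsingleton
    have h1 : Subsingleton (Localization.AtPrime q ⊗[C] (C ⊗[A] H1Cotangent K A)) :=
      (LinearEquiv.lTensor _ e).toEquiv.subsingleton
    have h2 : Subsingleton (Localization.AtPrime q ⊗[A] H1Cotangent K A) :=
      (TensorProduct.AlgebraTensorModule.cancelBaseChange A C C (Localization.AtPrime q)
        (H1Cotangent K A)).symm.toEquiv.subsingleton
    have h3 : Subsingleton (Localization.AtPrime q ⊗[Localization.AtPrime p]
        (Localization.AtPrime p ⊗[A] H1Cotangent K A)) :=
      (TensorProduct.AlgebraTensorModule.cancelBaseChange A (Localization.AtPrime p)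
        (Localization.AtPrime p) (Localization.AtPrime q) (H1Cotangent K A)).toEquiv.subsingleton
    have h4 := Module.FaithfullyFlat.lTensor_reflects_triviality (Localization.AtPrime p)
      (Localization.AtPrime q) (Localization.AtPrime p ⊗[A] H1Cotangent K A)
    exact e1.symm.toEquiv.subsingleton

theorem smoothAt_descent {K A C : Type*} [CommRing K] [CommRing A] [CommRing C]
    [Algebra K A] [Algebra A C] [Algebra K C] [IsScalarTower K A C]
    [Algebra.FiniteType K A] [Algebra.Etale A C] (p : Ideal A) [p.IsPrime]
    (q : Ideal C) [q.IsPrime] (hpq : q.comap (algebraMap A C) = p)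
    (h : Algebra.IsSmoothAt K q) : Algebra.IsSmoothAt K p := by
  have : Algebra.IsEtaleAt A q := by
    have : FormallyEtale C (Localization.AtPrime q) := .of_isLocalization q.primeCompl
    exact FormallyEtale.comp A C _
  obtain ⟨f, hf, hst⟩ := Algebra.IsEtaleAt.exists_isStandardEtale (R := A) q
  have hd : Disjoint (Submonoid.powers f : Set C) (q : Set C) :=
    (Ideal.disjoint_powers_iff_notMem_of_isPrime _).mpr hf
  have hq' := IsLocalization.isPrime_of_isPrime_disjoint (Submonoid.powers f)
    (Localization.Away f) q inferInstance hd
  have hc := IsLocalization.under_map_of_isPrime_disjoint (Submonoid.powers f)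
    (Localization.Away f) (I := q) inferInstance hd
  let q' : PrimeSpectrum (Localization.Away f) := ⟨_, hq'⟩
  have hm : q' ∈ smoothLocus K (Localization.Away f) := by
    rw [← smoothLocus_comap_of_isLocalization (A := C) f]
    change IsSmoothAt K _
    convert h
    exact hc
  have : q'.asIdeal.LiesOver p := ⟨by
    rw [Ideal.under_def, IsScalarTower.algebraMap_eq A C (Localization.Away f), ← Ideal.comap_comap,
      ← Ideal.under_def, ← Ideal.under_def, hc, Ideal.under_def, hpq]⟩
  exact smoothAt_descent_std p q'.asIdeal hm
end

section
open TensorProduct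

namespace NeronSemistable

theorem std_rel (R : Type u) [CommRing R] (n l : ℕ) (b : R) :
    (∏ i : Fin n, if (i : ℕ) < l then stdCoord R n l b i else 1) =
      algebraMap R (stdRing R n l b) b := by
  have h : (Ideal.Quotient.mk (Ideal.span {(∏ i : Fin n, if (i : ℕ) < l then
      (MvPolynomial.X i : MvPolynomial (Fin n) R) else 1) - MvPolynomial.C b}))
      ((∏ i : Fin n, if (i : ℕ) < l then MvPolynomial.X i else 1) - MvPolynomial.C b) = 0 :=
    Ideal.Quotient.eq_zero_iff_mem.2 (Ideal.subset_span rfl)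
  rw [map_sub, sub_eq_zero, map_prod] at h
  refine Eq.trans ?_ h
  refine Finset.prod_congr rfl fun i _ => ?_
  split_ifs <;> simp [stdCoord]

theorem std_lift {R : Type u} [CommRing R] {n l : ℕ} {b : R} {B : Type*} [CommRing B]
    [Algebra R B] (t : Fin n → B)
    (ht : (∏ i : Fin n, if (i : ℕ) < l then t i else 1) = algebraMap R B b) :
    ∃ φ : stdRing R n l b →ₐ[R] B, ∀ i, φ (stdCoord R n l b i) = t i := by
  refine ⟨Ideal.Quotient.liftₐ _ (MvPolynomial.aeval t) ?_, fun i => ?_⟩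
  · intro a ha
    have : Ideal.span {(∏ i : Fin n, if (i : ℕ) < l then
      (MvPolynomial.X i : MvPolynomial (Fin n) R) else 1) - MvPolynomial.C b} ≤
        RingHom.ker (MvPolynomial.aeval t : _ →ₐ[R] B).toRingHom := by
      rw [Ideal.span_le, Set.singleton_subset_iff]
      simp only [SetLike.mem_coe, RingHom.mem_ker]
      simp only [AlgHom.toRingHom_eq_coe, RingHom.coe_coe, map_sub, map_prod, apply_ite
        (MvPolynomial.aeval t), MvPolynomial.aeval_X, map_one, MvPolynomial.algHom_C, ht, sub_self]
    exact this ha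
  · exact (Ideal.Quotient.lift_mk _ _ _).trans (MvPolynomial.aeval_X t i)

theorem std_hom_ext {R : Type u} [CommRing R] {n l : ℕ} {b : R} {B : Type*} [CommRing B]
    [Algebra R B] (φ ψ : stdRing R n l b →ₐ[R] B)
    (h : ∀ i, φ (stdCoord R n l b i) = ψ (stdCoord R n l b i)) : φ = ψ := by
  apply Ideal.Quotient.algHom_ext
  apply MvPolynomial.algHom_ext
  intro i
  exact h i

/-- lifting through formally etale algebras -/
theorem fe_lift {R D T B : Type*} [CommRing R] [CommRing D] [Algebra R D] [CommRing T]
    [Algebra R T] [Algebra D T] [IsScalarTower R D T] [Algebra.FormallyEtale D T] [CommRing B]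
    [Algebra R B] (I : Ideal B) (hI : I ^ 2 = ⊥) (φ : T →ₐ[R] B ⧸ I) (ψ : D →ₐ[R] B)
    (h : ∀ d, Ideal.Quotient.mk I (ψ d) = φ (algebraMap D T d)) :
    ∃ χ : T →ₐ[R] B, (∀ t, Ideal.Quotient.mk I (χ t) = φ t) ∧
      ∀ d, χ (algebraMap D T d) = ψ d := by
  let := ψ.toRingHom.toAlgebra
  obtain ⟨χ, hχ⟩ := (Algebra.FormallyEtale.comp_bijective (R := D) (A := T) I hI).2
    { φ with commutes' := fun d => (h d).symm }
  refine ⟨{ χ.toRingHom with commutes' := fun r => ?_ }, fun t => ?_, fun d => ?_⟩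
  · have := χ.commutes (algebraMap R D r)
    rw [← IsScalarTower.algebraMap_apply] at this
    exact this.trans (ψ.commutes r)
  · exact DFunLike.congr_fun hχ t
  · exact χ.commutes d

theorem isUnit_of_mk {B : Type*} [CommRing B] {I : Ideal B} (hI : I ^ 2 = ⊥) {x : B}
    (h : IsUnit (Ideal.Quotient.mk I x)) : IsUnit x := by
  obtain ⟨y, hy⟩ := h.exists_right_inv
  obtain ⟨y, rfl⟩ := Ideal.Quotient.mk_surjective y
  rw [← map_mul, ← map_one (Ideal.Quotient.mk I), Ideal.Quotient.eq] at hy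
  have h0 : (x * y - 1) ^ 2 = 0 := by
    have := Ideal.pow_mem_pow hy 2
    rwa [hI, Ideal.mem_bot] at this
  exact IsUnit.of_mul_eq_one (y * (2 - x * y)) (by linear_combination -h0)

theorem std_smooth_one {R : Type u} [CommRing R] {n l : ℕ} {b : R} {T : Type*} [CommRing T]
    [Algebra R T] [Algebra (stdRing R n l b) T] [IsScalarTower R (stdRing R n l b) T]
    [Algebra.FormallyEtale (stdRing R n l b) T] (i : Fin n) (hi : (i : ℕ) < l)
    (hu : IsUnit (algebraMap (stdRing R n l b) T
      (∏ k ∈ Finset.univ.erase i, if (k : ℕ) < l then stdCoord R n l b k else 1))) :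
    Algebra.FormallySmooth R T := by
  refine .of_comp_surjective fun B _ _ I hI φ => ?_
  choose t ht using fun k => Ideal.Quotient.mk_surjective (φ (algebraMap _ T (stdCoord R n l b k)))
  have hv : Ideal.Quotient.mk I (∏ k ∈ Finset.univ.erase i, if (k : ℕ) < l then t k else 1) =
      φ (algebraMap (stdRing R n l b) T
      (∏ k ∈ Finset.univ.erase i, if (k : ℕ) < l then stdCoord R n l b k else 1)) := by
    rw [map_prod, map_prod, map_prod]
    refine Finset.prod_congr rfl fun k _ => ?_
    split_ifs
    · exact ht k
    · simp
  have hvu : IsUnit (∏ k ∈ Finset.univ.erase i, if (k : ℕ) < l then t k else 1) := by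
    apply isUnit_of_mk hI
    rw [hv]
    exact hu.map φ
  set v := ∏ k ∈ Finset.univ.erase i, if (k : ℕ) < l then t k else 1 with hvdef
  obtain ⟨w, hw⟩ := hvu.exists_right_inv
  have hrel : φ (algebraMap (stdRing R n l b) T (stdCoord R n l b i)) * Ideal.Quotient.mk I v =
      algebraMap R (B ⧸ I) b := by
    rw [hv, ← map_mul, ← map_mul]
    have h1 := std_rel R n l b
    rw [← Finset.mul_prod_erase _ _ (Finset.mem_univ i), if_pos hi] at h1
    rw [h1, ← IsScalarTower.algebraMap_apply, AlgHom.commutes]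
  obtain ⟨ψ, hψ⟩ := std_lift (R := R) (n := n) (l := l) (b := b)
    (fun k => if k = i then algebraMap R B b * w else t k) (by
      rw [← Finset.mul_prod_erase _ _ (Finset.mem_univ i), if_pos hi, if_pos rfl]
      rw [show (∏ x ∈ Finset.univ.erase i, if (x:ℕ) < l then (if x = i then algebraMap R B b * w
        else t x) else 1) = v from ?_]
      · linear_combination (algebraMap R B b) * hw
      · refine Finset.prod_congr rfl fun k hk => ?_
        rw [if_neg (Finset.ne_of_mem_erase hk)])
  obtain ⟨χ, hχ, -⟩ := fe_lift I hI φ ψ (by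
    intro d
    refine DFunLike.congr_fun (std_hom_ext ((Ideal.Quotient.mkₐ R I).comp ψ)
      (φ.comp (IsScalarTower.toAlgHom R _ T)) fun k => ?_) d
    simp only [AlgHom.comp_apply, hψ, Ideal.Quotient.mkₐ_eq_mk, IsScalarTower.coe_toAlgHom']
    split_ifs with hk
    · subst hk
      have hw' : Ideal.Quotient.mk I v * Ideal.Quotient.mk I w = 1 := by
        rw [← map_mul, hw, map_one]
      have : Ideal.Quotient.mk I (algebraMap R B b) = algebraMap R (B ⧸ I) b := rfl
      rw [map_mul, this, ← hrel]
      linear_combination (φ (algebraMap (stdRing R n l b) T (stdCoord R n l b k))) * hw'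
    · exact ht k)
  exact ⟨χ, AlgHom.ext hχ⟩

theorem std_smooth_zero {R : Type u} [CommRing R] {n : ℕ} {b : R} {T : Type*} [CommRing T]
    [Algebra R T] [Algebra (stdRing R n 0 b) T] [IsScalarTower R (stdRing R n 0 b) T]
    [Algebra.FormallyEtale (stdRing R n 0 b) T] (g : R) (hg : g * (1 - b) = 0)
    (hu : IsUnit (algebraMap R T g)) :
    Algebra.FormallySmooth R T := by
  refine .of_comp_surjective fun B _ _ I hI φ => ?_
  choose t ht using fun k => Ideal.Quotient.mk_surjective (φ (algebraMap _ T (stdCoord R n 0 b k)))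
  have hgu : IsUnit (algebraMap R B g) := isUnit_of_mk hI (by
    have := hu.map φ
    rwa [AlgHom.commutes] at this)
  obtain ⟨ψ, hψ⟩ := std_lift (R := R) (n := n) (l := 0) (b := b) t (by
    simp only [not_lt_zero, if_false, Finset.prod_const_one]
    have := congrArg (algebraMap R B) hg
    rw [map_mul, map_zero, hgu.mul_right_eq_zero, map_sub, map_one, sub_eq_zero] at this
    exact this)
  obtain ⟨χ, hχ, -⟩ := fe_lift I hI φ ψ (by
    intro d
    refine DFunLike.congr_fun (std_hom_ext ((Ideal.Quotient.mkₐ R I).comp ψ)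
      (φ.comp (IsScalarTower.toAlgHom R _ T)) fun k => ?_) d
    simp only [AlgHom.comp_apply, hψ, Ideal.Quotient.mkₐ_eq_mk, IsScalarTower.coe_toAlgHom']
    exact ht k)
  exact ⟨χ, AlgHom.ext hχ⟩

theorem std_smooth_two {R : Type u} [CommRing R] {n l : ℕ} {b : R} {T : Type*} [CommRing T]
    [Algebra R T] [Algebra (stdRing R n l b) T] [IsScalarTower R (stdRing R n l b) T]
    [Algebra.FormallyEtale (stdRing R n l b) T] (i j : Fin n) (hi : (i : ℕ) < l)
    (g : R) (hg : g * b = 0) (hu : IsUnit (algebraMap R T g)) :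
    Algebra.FormallySmooth R (T ⧸ Ideal.span {algebraMap (stdRing R n l b) T (stdCoord R n l b i),
      algebraMap (stdRing R n l b) T (stdCoord R n l b j)}) := by
  generalize hJ : Ideal.span {algebraMap (stdRing R n l b) T (stdCoord R n l b i),
      algebraMap (stdRing R n l b) T (stdCoord R n l b j)} = J
  refine .of_comp_surjective fun B _ _ I hI φ => ?_
  have hiJ : Ideal.Quotient.mk J (algebraMap (stdRing R n l b) T (stdCoord R n l b i)) = 0 :=
    Ideal.Quotient.eq_zero_iff_mem.2 (hJ ▸ Ideal.subset_span (by simp))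
  have hjJ : Ideal.Quotient.mk J (algebraMap (stdRing R n l b) T (stdCoord R n l b j)) = 0 :=
    Ideal.Quotient.eq_zero_iff_mem.2 (hJ ▸ Ideal.subset_span (by simp))
  let φ' : T →ₐ[R] B ⧸ I := φ.comp (Ideal.Quotient.mkₐ R J)
  choose t ht using fun k => Ideal.Quotient.mk_surjective (φ' (algebraMap _ T (stdCoord R n l b k)))
  have hgu : IsUnit (algebraMap R B g) := isUnit_of_mk hI (by
    have := hu.map φ'
    rwa [AlgHom.commutes] at this)
  obtain ⟨ψ, hψ⟩ := std_lift (R := R) (n := n) (l := l) (b := b)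
    (fun k => if k = i ∨ k = j then 0 else t k) (by
    rw [Finset.prod_eq_zero (Finset.mem_univ i) (by simp [hi])]
    have := congrArg (algebraMap R B) hg
    rw [map_mul, map_zero, hgu.mul_right_eq_zero] at this
    exact this.symm)
  obtain ⟨χ, hχ, hχ'⟩ := fe_lift I hI φ' ψ (by
    intro d
    refine DFunLike.congr_fun (std_hom_ext ((Ideal.Quotient.mkₐ R I).comp ψ)
      (φ'.comp (IsScalarTower.toAlgHom R _ T)) fun k => ?_) d
    simp only [AlgHom.comp_apply, hψ, Ideal.Quotient.mkₐ_eq_mk, IsScalarTower.coe_toAlgHom']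
    split_ifs with hk
    · rw [map_zero]
      rcases hk with rfl | rfl
      · simp [φ', hiJ]
      · simp [φ', hjJ]
    · exact ht k)
  have hker : ∀ a ∈ J, χ a = 0 := by
    intro a ha
    have : J ≤ RingHom.ker χ.toRingHom := by
      rw [← hJ, Ideal.span_le]
      rintro _ (rfl | rfl)
      · change χ _ = 0
        rw [hχ', hψ]; simp
      · change χ _ = 0
        rw [hχ', hψ]; simp
    exact this ha
  refine ⟨Ideal.Quotient.liftₐ J χ hker, ?_⟩
  apply Ideal.Quotient.algHom_ext
  ext t
  exact hχ t

end NeronSemistable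
end

section
open TensorProduct IsLocalRing AlgebraicGeometry CategoryTheory CategoryTheory.Limits

theorem pushout_prime {S T₁ T₂ W : Type u} [CommRing S] [CommRing T₁] [CommRing T₂] [CommRing W]
    [Algebra S T₁] [Algebra S T₂] [Algebra S W] [Algebra T₁ W] [Algebra T₂ W]
    [IsScalarTower S T₁ W] [IsScalarTower S T₂ W] [h : Algebra.IsPushout S T₁ T₂ W]
    (p₁ : Ideal T₁) [h₁ : p₁.IsPrime] (p₂ : Ideal T₂) [h₂ : p₂.IsPrime]
    (h12 : p₁.comap (algebraMap S T₁) = p₂.comap (algebraMap S T₂)) :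
    ∃ P : Ideal W, P.IsPrime ∧ P.comap (algebraMap T₁ W) = p₁ ∧
      P.comap (algebraMap T₂ W) = p₂ := by
  have hp := isPullback_SpecMap_of_isPushout _ _ _ _ (CommRingCat.isPushout_iff_isPushout.2 h)
  obtain ⟨z, hz1, hz2⟩ := Scheme.exists_preimage_of_isPullback hp
    (⟨p₁, h₁⟩ : PrimeSpectrum T₁) (⟨p₂, h₂⟩ : PrimeSpectrum T₂)
    (PrimeSpectrum.ext h12)
  exact ⟨z.asIdeal, z.isPrime, congrArg PrimeSpectrum.asIdeal hz1,
    congrArg PrimeSpectrum.asIdeal hz2⟩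

theorem smoothAt_of_away {R K C CK : Type*} [CommRing R] [CommRing K] [CommRing C] [CommRing CK]
    [Algebra R K] [Algebra R C] [Algebra R CK] [Algebra K CK] [Algebra C CK]
    [IsScalarTower R K CK] [IsScalarTower R C CK] [Algebra.IsPushout R K C CK]
    [Algebra.FinitePresentation R C]
    (h : C) [Algebra.FormallySmooth R (Localization.Away h)] (q : Ideal CK) [hq : q.IsPrime]
    (hh : algebraMap C CK h ∉ q) : Algebra.IsSmoothAt K q := by
  have e := Algebra.IsPushout.equiv R K C CK
  have : Algebra.FinitePresentation K CK := .equiv e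
  have e1 := (Algebra.IsPushout.cancelBaseChangeAlg R K C CK (Localization.Away h))
  have : Algebra.FormallySmooth K (CK ⊗[C] Localization.Away h) := .of_equiv e1.symm
  have e2 := IsLocalization.algEquiv (.powers (algebraMap C CK h))
    (CK ⊗[C] Localization.Away h) (Localization.Away (algebraMap C CK h))
  have : Algebra.FormallySmooth K (Localization.Away (algebraMap C CK h)) :=
    .of_equiv (e2.restrictScalars K)
  exact Algebra.basicOpen_subset_smoothLocus_iff.2 this
    (show (⟨q, hq⟩ : PrimeSpectrum CK) ∈ _ from hh)

theorem minimalPrimes_unique' {R B L BL : Type*} [CommRing R] [HenselianLocalRing R]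
    [IsSepClosed (ResidueField R)] [CommRing B] [Algebra R B] [Algebra.Smooth R B]
    [Field L] [Algebra R L] [CommRing BL] [Algebra R BL] [Algebra L BL] [Algebra B BL]
    [IsScalarTower R L BL] [IsScalarTower R B BL] [Algebra.IsPushout R L B BL]
    (p : Ideal B) [p.IsPrime] (hp : p.comap (algebraMap R B) = maximalIdeal R)
    (Q₁ Q₂ : Ideal BL) (hQ₁ : Q₁ ∈ minimalPrimes BL)
    (hQ₂ : Q₂ ∈ minimalPrimes BL)
    (h₁ : Q₁.comap (algebraMap B BL) ≤ p) (h₂ : Q₂.comap (algebraMap B BL) ≤ p) :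
    Q₁ = Q₂ := by
  have : Algebra.IsPushout R B L BL := .symm ‹_›
  have e := Algebra.IsPushout.equiv R B L BL
  have key := minimalPrimes_unique (R := R) (L := L) p hp _ _
    (minimalPrimes_comap_equiv e.toRingEquiv _ hQ₁) (minimalPrimes_comap_equiv e.toRingEquiv _ hQ₂)
    (by intro x hx
        apply h₁
        have : e (algebraMap B _ x) ∈ Q₁ := hx
        rwa [AlgEquiv.commutes] at this)
    (by intro x hx
        apply h₂
        have : e (algebraMap B _ x) ∈ Q₂ := hx
        rwa [AlgEquiv.commutes] at this)
  ext x
  have h := congrArg (fun I => e.symm x ∈ I) key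
  simpa using h

theorem exists_annihilator {R R' K W : Type*} [CommRing R] [HenselianLocalRing R]
    [IsSepClosed (ResidueField R)] [CommRing R'] [Algebra R R'] [Algebra.Etale R R']
    [Field K] [Algebra R K] [Module.Flat R K] [FaithfulSMul R K] [CommRing W] [Algebra R W]
    [Algebra R' W] [Algebra K W]
    [IsScalarTower R R' W] [IsScalarTower R K W]
    (s' : Ideal R') [s'.IsPrime] (hs' : s'.comap (algebraMap R R') = maximalIdeal R)
    (q : Ideal W) [q.IsPrime] (hq : q.comap (algebraMap R' W) ≤ s')
    (β : R') (hβ : algebraMap R' W β ∈ q) : ∃ g, g ∉ s' ∧ g * β = 0 := by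
  let φ : R' ⊗[R] K →ₐ[R] W := Algebra.TensorProduct.lift (IsScalarTower.toAlgHom R R' W)
    (IsScalarTower.toAlgHom R K W) (fun _ _ => .all _ _)
  have hφ : ∀ r, φ (algebraMap R' _ r) = algebraMap R' W r := fun r => by
    simp [φ, Algebra.TensorProduct.algebraMap_apply]
  let e : Ideal (R' ⊗[R] K) := q.comap φ.toRingHom
  have he : e.IsPrime := inferInstance
  have hmin : ∀ P : Ideal (R' ⊗[R] K), P.IsPrime → P ∈ minimalPrimes (R' ⊗[R] K) := by
    have e1 : R' ⊗[R] K ≃ₐ[R] K ⊗[R] R' := Algebra.TensorProduct.comm R R' K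
    have : IsArtinianRing (K ⊗[R] R') := by
      have : Module.Finite K (K ⊗[R] R') := Algebra.FormallyUnramified.finite_of_free K _
      exact IsArtinianRing.of_finite K _
    have : IsArtinianRing (R' ⊗[R] K) := e1.symm.toRingEquiv.surjective.isArtinianRing (f := e1.symm.toRingEquiv.toRingHom)
    intro P hP
    have hPm : P.IsMaximal := inferInstance
    refine ⟨⟨hP, bot_le⟩, fun Q hQ hQP => ?_⟩
    have := hQ.1
    have hQm : Q.IsMaximal := inferInstance
    rw [hQm.eq_of_le hP.ne_top hQP]
  by_contra! hcon
  have hinj : Function.Injective (algebraMap R' (R' ⊗[R] K)) :=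
    Algebra.TensorProduct.includeLeft_injective (R := R) (S := R) (A := R') (B := K)
      (FaithfulSMul.algebraMap_injective R K)
  -- prime avoiding
  have hred : IsReduced (R' ⊗[R] K) := by
    have e1 : R' ⊗[R] K ≃ₐ[R] K ⊗[R] R' := Algebra.TensorProduct.comm R R' K
    have : IsReduced (K ⊗[R] R') := Algebra.FormallyUnramified.isReduced_of_field K _
    exact isReduced_of_injective e1 e1.injective
  let M : Submonoid (R' ⊗[R] K) := (s'.primeCompl ⊔ .powers β).map (algebraMap R' (R' ⊗[R] K))
  have hM : (0 : R' ⊗[R] K) ∉ M := by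
    rintro ⟨x, hx, hx0⟩
    rw [map_eq_zero_iff _ hinj] at hx0
    subst hx0
    obtain ⟨g, hg, _, ⟨n, rfl⟩, h⟩ := Submonoid.mem_sup.1 hx
    have hgn : (algebraMap R' (R' ⊗[R] K) (g * β)) ^ (n + 1) = 0 := by
      rw [← map_pow, mul_pow, pow_succ g, pow_succ β]
      have h' : g * β ^ n = 0 := h
      rw [show g ^ n * g * (β ^ n * β) = (g * β ^ n) * (g ^ n * β) by ring, h', zero_mul, map_zero]
    have := eq_zero_of_pow_eq_zero hgn
    rw [map_eq_zero_iff _ hinj] at this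
    exact hcon g hg this
  obtain ⟨P, hP, -, hPM⟩ := Ideal.exists_le_prime_disjoint (⊥ : Ideal (R' ⊗[R] K)) M (by
    rw [Set.disjoint_left]
    intro x hx hxM
    rw [SetLike.mem_coe, Ideal.mem_bot] at hx
    exact hM (hx ▸ hxM))
  have hPe : P = e := minimalPrimes_unique (R := R) (L := K) s' hs' P e (hmin P hP) (hmin e he)
    (by
      intro x hx
      by_contra hxs
      exact Set.disjoint_left.1 hPM hx ⟨x, Submonoid.mem_sup_left hxs, rfl⟩)
    (by
      intro x hx
      apply hq
      have : φ (algebraMap R' _ x) ∈ q := hx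
      rwa [hφ] at this)
  have hβP : algebraMap R' (R' ⊗[R] K) β ∈ P := by
    rw [hPe]
    show φ (algebraMap R' _ β) ∈ q
    rwa [hφ]
  exact Set.disjoint_left.1 hPM hβP ⟨β, Submonoid.mem_sup_right (Submonoid.mem_powers β), rfl⟩
end

section
open TensorProduct IsLocalRing AlgebraicGeometry CategoryTheory CategoryTheory.Limits
namespace NeronSemistable

instance std_fp (R : Type u) [CommRing R] (n l : ℕ) (b : R) :
    Algebra.FinitePresentation R (stdRing R n l b) :=
  Algebra.FinitePresentation.quotient ⟨{_}, by rw [Finset.coe_singleton]⟩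

theorem X_dvd_of_dvd_mul_pow {σ R : Type*} [CommRing R] [DecidableEq σ] {m k : σ}
    (P : MvPolynomial σ R) (hmk : k ≠ m) (N : ℕ)
    (h : MvPolynomial.X m ∣ P * MvPolynomial.X k ^ N) : MvPolynomial.X m ∣ P := by
  induction N with
  | zero => simpa using h
  | succ N ih =>
    apply ih
    rw [pow_succ, ← mul_assoc] at h
    rw [MvPolynomial.X_dvd_iff_modMonomial_eq_zero] at h ⊢
    ext c
    have hc := congrArg (MvPolynomial.coeff (c + Finsupp.single k 1)) h
    by_cases hcm : Finsupp.single m 1 ≤ c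
    · rw [MvPolynomial.coeff_modMonomial_of_le _ hcm, MvPolynomial.coeff_zero]
    · rw [MvPolynomial.coeff_modMonomial_of_not_le _ hcm]
      have hcm' : ¬ Finsupp.single m 1 ≤ c + Finsupp.single k 1 := by
        rw [Finsupp.single_le_iff] at hcm ⊢
        simpa [Finsupp.single_apply, hmk] using hcm
      rwa [MvPolynomial.coeff_modMonomial_of_not_le _ hcm', MvPolynomial.coeff_mul_X] at hc

theorem std_sub_prime {R : Type u} [CommRing R] {n l : ℕ} {b : R} (d : Ideal (stdRing R n l b))
    [d.IsPrime] (i j : Fin n) (hij : i ≠ j) (hi : (i : ℕ) < l) (hj : (j : ℕ) < l)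
    (hid : stdCoord R n l b i ∈ d) (hjd : stdCoord R n l b j ∈ d) (g : R)
    (hg : algebraMap R (stdRing R n l b) g ∉ d) (hgb : g * b = 0) (k : Fin n) :
    ∃ d₁ : Ideal (stdRing R n l b), d₁.IsPrime ∧ d₁ ≤ d ∧ stdCoord R n l b k ∉ d₁ := by
  -- choose m
  obtain ⟨m, hmk, hm, hmd⟩ : ∃ m : Fin n, k ≠ m ∧ (m : ℕ) < l ∧ stdCoord R n l b m ∈ d := by
    by_cases h : k = i
    · exact ⟨j, h ▸ hij, hj, hjd⟩
    · exact ⟨i, h, hi, hid⟩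
  let M : Submonoid (stdRing R n l b) := d.primeCompl ⊔ .powers (stdCoord R n l b k)
  have hM : (0 : stdRing R n l b) ∉ M := by
    intro h0
    obtain ⟨s, hs, _, ⟨N, rfl⟩, h⟩ := Submonoid.mem_sup.1 h0
    obtain ⟨S, rfl⟩ := Ideal.Quotient.mk_surjective s
    have h1 : Ideal.Quotient.mk (Ideal.span {(∏ i : Fin n, if (i : ℕ) < l then
      (MvPolynomial.X i : MvPolynomial (Fin n) R) else 1) - MvPolynomial.C b})
      (S * MvPolynomial.X k ^ N) = 0 := by
      rw [map_mul, map_pow]; exact h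
    rw [Ideal.Quotient.eq_zero_iff_mem, Ideal.mem_span_singleton] at h1
    obtain ⟨t, ht⟩ := h1
    -- multiply by g, reduce mod X m
    have h2 : MvPolynomial.C g * S * MvPolynomial.X k ^ N ∈
        Ideal.span {(MvPolynomial.X m : MvPolynomial (Fin n) R)} := by
      rw [mul_assoc, ht, Ideal.mem_span_singleton, ← Finset.mul_prod_erase _ _ (Finset.mem_univ m),
        if_pos hm]
      refine ⟨MvPolynomial.C g * (∏ x ∈ Finset.univ.erase m, if (x : ℕ) < l then
        (MvPolynomial.X x : MvPolynomial (Fin n) R) else 1) * t, ?_⟩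
      have : (MvPolynomial.C g * MvPolynomial.C b : MvPolynomial (Fin n) R) = 0 := by
        rw [← map_mul, hgb, map_zero]
      linear_combination (-t) * this
    have h5 := X_dvd_of_dvd_mul_pow (MvPolynomial.C g * S) hmk N (Ideal.mem_span_singleton.1 h2)
    obtain ⟨w, hw⟩ := h5
    have h6 : algebraMap R (stdRing R n l b) g * Ideal.Quotient.mk _ S =
      stdCoord R n l b m * Ideal.Quotient.mk _ w := by
      have := congrArg (Ideal.Quotient.mk (Ideal.span {(∏ i : Fin n, if (i : ℕ) < l then
        (MvPolynomial.X i : MvPolynomial (Fin n) R) else 1) - MvPolynomial.C b})) hw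
      rw [map_mul, map_mul] at this
      exact this
    have h7 := d.mul_mem_right (Ideal.Quotient.mk _ w) hmd
    rw [← h6] at h7
    rcases Ideal.IsPrime.mem_or_mem ‹_› h7 with h | h
    · exact hg h
    · exact hs h
  obtain ⟨P, hP, -, hPM⟩ := Ideal.exists_le_prime_disjoint (⊥ : Ideal (stdRing R n l b)) M (by
    rw [Set.disjoint_left]
    intro x hx hxM
    rw [SetLike.mem_coe, Ideal.mem_bot] at hx
    exact hM (hx ▸ hxM))
  refine ⟨P, hP, fun x hx => ?_, fun hx => ?_⟩
  · by_contra hxd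
    exact Set.disjoint_left.1 hPM hx (Submonoid.mem_sup_left hxd)
  · exact Set.disjoint_left.1 hPM hx (Submonoid.mem_sup_right (Submonoid.mem_powers _))

theorem exists_pair {R : Type*} {R' : Type u} {K C CK : Type*} [CommRing R] [HenselianLocalRing R]
    [IsSepClosed (ResidueField R)] [CommRing R'] [Algebra R R'] [Algebra.Etale R R']
    [Field K] [Algebra R K] [Module.Flat R K] [FaithfulSMul R K]
    {n l : ℕ} (hln : l ≤ n) {b : R'}
    [CommRing C] [Algebra R C] [Algebra R' C] [IsScalarTower R R' C]
    [Algebra (stdRing R' n l b) C] [IsScalarTower R' (stdRing R' n l b) C]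
    [Algebra.Etale (stdRing R' n l b) C]
    [CommRing CK] [Algebra R CK] [Algebra K CK] [Algebra C CK] [Algebra R' CK]
    [IsScalarTower R' C CK] [IsScalarTower R R' CK]
    [IsScalarTower R K CK] [IsScalarTower R C CK] [Algebra.IsPushout R K C CK]
    (P : Ideal C) [P.IsPrime] (hP : P.comap (algebraMap R C) = maximalIdeal R)
    (q : Ideal CK) [q.IsPrime] (hq : q.comap (algebraMap C CK) ≤ P)
    (hns : ¬ Algebra.IsSmoothAt K q) :
    ∃ i j : Fin n, i ≠ j ∧ (i : ℕ) < l ∧ (j : ℕ) < l ∧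
      algebraMap C CK (algebraMap _ C (stdCoord R' n l b i)) ∈ q ∧
      algebraMap C CK (algebraMap _ C (stdCoord R' n l b j)) ∈ q := by
  by_contra! hcon
  apply hns
  have : Algebra.FinitePresentation R' C := .trans R' (stdRing R' n l b) C
  have : Algebra.FinitePresentation R C := .trans R R' C
  have hs' : (P.comap (algebraMap R' C)).comap (algebraMap R R') = maximalIdeal R := by
    rw [Ideal.comap_comap, ← IsScalarTower.algebraMap_eq, hP]
  have hq' : q.comap (algebraMap R' CK) ≤ P.comap (algebraMap R' C) := by
    rw [IsScalarTower.algebraMap_eq R' C CK, ← Ideal.comap_comap]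
    exact Ideal.comap_mono hq
  rcases Nat.eq_zero_or_pos l with rfl | hl
  · obtain ⟨g, hg, hgb⟩ := exists_annihilator (R := R) (K := K) (P.comap (algebraMap R' C)) hs' q hq'
      (1 - b) (by
        have h1 := std_rel R' n 0 b
        simp only [not_lt_zero, if_false, Finset.prod_const_one] at h1
        rw [IsScalarTower.algebraMap_apply R' C CK, IsScalarTower.algebraMap_apply R' (stdRing R' n 0 b) C,
          map_sub, map_one, ← h1, sub_self, map_zero, map_zero]
        exact q.zero_mem)
    let h := algebraMap R' C g
    have : Algebra.FormallyEtale C (Localization.Away h) := .of_isLocalization (.powers h)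
    have : Algebra.FormallyEtale (stdRing R' n 0 b) (Localization.Away h) := .comp _ C _
    have : Algebra.FormallySmooth R' (Localization.Away h) := std_smooth_zero (b := b) (n := n) g hgb (by
      rw [IsScalarTower.algebraMap_apply R' C]
      exact IsLocalization.Away.algebraMap_isUnit h)
    have : Algebra.FormallySmooth R (Localization.Away h) := .comp _ R' _
    refine smoothAt_of_away (R := R) h q ?_
    intro hh
    exact hg (hq hh)
  · obtain ⟨i, hi, hmem⟩ : ∃ i : Fin n, (i : ℕ) < l ∧ ∀ k : Fin n, k ≠ i → (k : ℕ) < l →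
        algebraMap C CK (algebraMap _ C (stdCoord R' n l b k)) ∉ q := by
      by_cases h : ∃ i : Fin n, (i : ℕ) < l ∧
          algebraMap C CK (algebraMap _ C (stdCoord R' n l b i)) ∈ q
      · obtain ⟨i, hi, hiq⟩ := h
        exact ⟨i, hi, fun k hk hkl => hcon i k hk.symm hi hkl hiq⟩
      · push Not at h
        exact ⟨⟨0, by omega⟩, hl, fun k _ hkl => h k hkl⟩
    let v := ∏ k ∈ Finset.univ.erase i, if (k : ℕ) < l then stdCoord R' n l b k else 1
    let h := algebraMap (stdRing R' n l b) C v
    have : Algebra.FormallyEtale C (Localization.Away h) := .of_isLocalization (.powers h)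
    have : Algebra.FormallyEtale (stdRing R' n l b) (Localization.Away h) := .comp _ C _
    have : Algebra.FormallySmooth R' (Localization.Away h) := std_smooth_one (b := b) (n := n) i hi (by
      rw [IsScalarTower.algebraMap_apply (stdRing R' n l b) C]
      exact IsLocalization.Away.algebraMap_isUnit h)
    have : Algebra.FormallySmooth R (Localization.Away h) := .comp _ R' _
    refine smoothAt_of_away (R := R) h q ?_
    simp only [h, v, map_prod]
    rw [Ideal.IsPrime.prod_mem_iff]
    push Not
    intro k hk
    split_ifs with hkl
    · exact hmem k (Finset.ne_of_mem_erase hk) hkl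
    · rw [map_one, map_one]
      exact (Ideal.ne_top_iff_one q).1 (Ideal.IsPrime.ne_top ‹_›)
end NeronSemistable
end

section
open TensorProduct IsLocalRing AlgebraicGeometry CategoryTheory CategoryTheory.Limits
namespace NeronSemistable

theorem minimalPrimes_unique_of_smoothAt {K C : Type*} [Field K] [CommRing C] [Algebra K C]
    [Algebra.FinitePresentation K C] (q : Ideal C) [q.IsPrime] (hs : Algebra.IsSmoothAt K q)
    (Q₁ Q₂ : Ideal C) (h₁ : Q₁ ∈ minimalPrimes C) (h₂ : Q₂ ∈ minimalPrimes C) (hq₁ : Q₁ ≤ q)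
    (hq₂ : Q₂ ≤ q) : Q₁ = Q₂ := by
  obtain ⟨f, hf, n, _, _, _⟩ :=
    Algebra.IsSmoothAt.exists_isStandardEtale_mvPolynomial (R := K) (p := q)
  by_contra hne
  have ht := fun Q hQ h ↦ minimalPrimes_transfer (A := C) (A' := Localization.Away f)
    f Q hQ (h : f ∉ Q)
  have hf₁ : f ∉ Q₁ := fun h ↦ hf (hq₁ h)
  have hf₂ : f ∉ Q₂ := fun h ↦ hf (hq₂ h)
  obtain ⟨e, he, he₁, he₂⟩ := exists_idem_separating (S := MvPolynomial (Fin n) K) _ _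
    (ht Q₁ h₁ hf₁).1 (ht Q₂ h₂ hf₂).1 (by
      intro h
      apply hne
      rw [← (ht Q₁ h₁ hf₁).2, h, (ht Q₂ h₂ hf₂).2])
  have hd : Disjoint (Submonoid.powers f : Set C) (q : Set C) :=
    (Ideal.disjoint_powers_iff_notMem_of_isPrime _).mpr hf
  have hp := IsLocalization.isPrime_of_isPrime_disjoint (Submonoid.powers f) (Localization.Away f)
    q inferInstance hd
  apply hp.ne_top
  rw [Ideal.eq_top_iff_one]
  have := Ideal.add_mem _ (Ideal.map_mono hq₁ he₁) (Ideal.map_mono hq₂ he₂)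
  rwa [add_sub_cancel] at this

theorem not_smoothAt_of_pair {R : Type*} {R' : Type u} {K C CK : Type*} [CommRing R]
    [CommRing R'] [Algebra R R'] [Algebra.FinitePresentation R R']
    [Field K] [Algebra R K] [Module.Flat R K]
    {n l : ℕ} {b : R'}
    [CommRing C] [Algebra R C] [Algebra R' C] [IsScalarTower R R' C]
    [Algebra (stdRing R' n l b) C] [IsScalarTower R' (stdRing R' n l b) C]
    [Algebra.Etale (stdRing R' n l b) C]
    [CommRing CK] [Algebra R CK] [Algebra K CK] [Algebra C CK]
    [IsScalarTower R K CK] [IsScalarTower R C CK] [Algebra.IsPushout R K C CK]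
    (q : Ideal CK) [q.IsPrime] (i j : Fin n) (hij : i ≠ j) (hi : (i : ℕ) < l) (hj : (j : ℕ) < l)
    (hiq : algebraMap C CK (algebraMap _ C (stdCoord R' n l b i)) ∈ q)
    (hjq : algebraMap C CK (algebraMap _ C (stdCoord R' n l b j)) ∈ q)
    (g : R') (hg : algebraMap C CK (algebraMap R' C g) ∉ q) (hgb : g * b = 0) :
    ¬ Algebra.IsSmoothAt K q := by
  intro hs
  have : Algebra.FinitePresentation R' C := .trans R' (stdRing R' n l b) C
  have : Algebra.FinitePresentation R C := .trans R R' C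
  have : Algebra.FinitePresentation K CK := .equiv (Algebra.IsPushout.equiv R K C CK)
  have hfl : Module.Flat C CK := by
    have : Algebra.IsPushout R C K CK := .symm ‹_›
    exact .of_linearEquiv (Algebra.IsPushout.equiv R C K CK).symm.toLinearEquiv
  let _ : Algebra (stdRing R' n l b) CK := ((algebraMap C CK).comp (algebraMap _ C)).toAlgebra
  have : IsScalarTower (stdRing R' n l b) C CK := .of_algebraMap_eq' rfl
  have hDC : Module.Flat (stdRing R' n l b) C := inferInstance
  have : Module.Flat (stdRing R' n l b) CK := .trans _ C _
  obtain ⟨M, hM, hMq⟩ := Ideal.exists_minimalPrimes_le (bot_le (a := q))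
  have hMp : M.IsPrime := hM.1.1
  have hmem : ∃ k : Fin n, (k : ℕ) < l ∧ algebraMap (stdRing R' n l b) CK (stdCoord R' n l b k) ∈ M := by
    have h1 := std_rel R' n l b
    have h2 : algebraMap (stdRing R' n l b) CK (algebraMap R' _ g) *
        algebraMap (stdRing R' n l b) CK
          (∏ i : Fin n, if (i : ℕ) < l then stdCoord R' n l b i else 1) ∈ M := by
      rw [h1, ← map_mul, ← map_mul, hgb, map_zero, map_zero]
      exact M.zero_mem
    rcases hMp.mem_or_mem h2 with h | h
    · refine absurd (hMq h) ?_
      rwa [IsScalarTower.algebraMap_apply _ C CK, ← IsScalarTower.algebraMap_apply R' _ C]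
    · rw [map_prod, Ideal.IsPrime.prod_mem_iff] at h
      obtain ⟨k, -, hk⟩ := h
      split_ifs at hk with hkl
      · exact ⟨k, hkl, hk⟩
      · rw [map_one] at hk
        exact absurd ((Ideal.eq_top_iff_one _).2 hk) hMp.ne_top
  obtain ⟨k, hkl, hk⟩ := hmem
  obtain ⟨d₁, hd₁, hd₁q, hkd₁⟩ := std_sub_prime (q.under (stdRing R' n l b)) i j hij hi hj hiq hjq g
    (by
      show algebraMap (stdRing R' n l b) CK _ ∉ q
      rwa [IsScalarTower.algebraMap_apply _ C CK, ← IsScalarTower.algebraMap_apply R' _ C]) hgb k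
  obtain ⟨q₁, hq₁q, hq₁, hq₁d⟩ := Ideal.exists_ideal_le_liesOver_of_le
    (q := q.under (stdRing R' n l b)) q hd₁q
  obtain ⟨M', hM', hM'q⟩ := Ideal.exists_minimalPrimes_le (bot_le (a := q₁))
  have hMM' := minimalPrimes_unique_of_smoothAt q hs M M' hM hM' hMq (hM'q.trans hq₁q)
  apply hkd₁
  rw [hq₁d.over]
  exact hM'q (hMM' ▸ hk)
end NeronSemistable
end

section
open TensorProduct IsLocalRing AlgebraicGeometry CategoryTheory CategoryTheory.Limits
namespace NeronSemistable

theorem smoothAt_ascent {K A C : Type*} [CommRing K] [CommRing A] [CommRing C] [Algebra K A]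
    [Algebra A C] [Algebra K C] [IsScalarTower K A C] [Algebra.Etale A C]
    (p : Ideal A) [p.IsPrime] (q : Ideal C) [q.IsPrime]
    (hpq : q.comap (algebraMap A C) = p) (h : Algebra.IsSmoothAt K p) :
    Algebra.IsSmoothAt K q := by
  have : q.LiesOver p := ⟨hpq.symm⟩
  let := Localization.AtPrime.algebraOfLiesOver p q
  have : Algebra.FormallyEtale C (Localization.AtPrime q) := .of_isLocalization q.primeCompl
  have : Algebra.FormallyEtale A (Localization.AtPrime q) := .comp _ C _
  have : Algebra.FormallyEtale (Localization.AtPrime p) (Localization.AtPrime q) :=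
    .localization_base p.primeCompl
  have : Algebra.FormallySmooth K (Localization.AtPrime p) := h
  have : IsScalarTower K (Localization.AtPrime p) (Localization.AtPrime q) :=
    .of_algebraMap_eq fun x => by
      rw [IsScalarTower.algebraMap_apply K A (Localization.AtPrime p),
        ← IsScalarTower.algebraMap_apply A (Localization.AtPrime p) (Localization.AtPrime q),
        IsScalarTower.algebraMap_apply K C (Localization.AtPrime q),
        IsScalarTower.algebraMap_apply K A C, ← IsScalarTower.algebraMap_apply A C]
  exact Algebra.FormallySmooth.comp K (Localization.AtPrime p) (Localization.AtPrime q)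

attribute [local instance] Algebra.TensorProduct.rightAlgebra in
theorem exists_pushout (R K A AK C : Type u) [CommRing R] [CommRing K] [CommRing A] [CommRing AK]
    [CommRing C] [Algebra R K] [Algebra R A] [Algebra R AK] [Algebra K AK] [Algebra A AK]
    [IsScalarTower R K AK] [IsScalarTower R A AK] [h : Algebra.IsPushout R K A AK]
    [Algebra A C] [Algebra R C] [IsScalarTower R A C] :
    ∃ (CK : Type u) (_ : CommRing CK) (_ : Algebra R CK) (_ : Algebra K CK) (_ : Algebra A CK)
      (_ : Algebra AK CK) (_ : Algebra C CK) (_ : IsScalarTower R K CK)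
      (_ : IsScalarTower R A CK) (_ : IsScalarTower R C CK) (_ : IsScalarTower K AK CK)
      (_ : IsScalarTower A AK CK) (_ : IsScalarTower A C CK) (_ : IsScalarTower R AK CK),
      Algebra.IsPushout A AK C CK ∧ Algebra.IsPushout R K C CK := by
  have i1 : IsScalarTower R K (AK ⊗[A] C) := inferInstance
  have i2 : IsScalarTower R A (AK ⊗[A] C) := .of_algebraMap_eq fun x => by
    rw [IsScalarTower.algebraMap_apply R AK (AK ⊗[A] C), IsScalarTower.algebraMap_apply R A AK,
      ← IsScalarTower.algebraMap_apply A AK]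
  have i3 : IsScalarTower R C (AK ⊗[A] C) := .of_algebraMap_eq fun x => by
    rw [IsScalarTower.algebraMap_apply R A (AK ⊗[A] C), IsScalarTower.algebraMap_apply R A C,
      ← IsScalarTower.algebraMap_apply A C]
  have i4 : IsScalarTower K AK (AK ⊗[A] C) := inferInstance
  have i5 : IsScalarTower R AK (AK ⊗[A] C) := inferInstance
  have h1 : Algebra.IsPushout A AK C (AK ⊗[A] C) := inferInstance
  refine ⟨AK ⊗[A] C, inferInstance, inferInstance, inferInstance, inferInstance, inferInstance,
    inferInstance, i1, i2, i3, i4, inferInstance, inferInstance, i5, h1, ?_⟩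
  have h' := h.symm
  exact ((Algebra.IsPushout.comp_iff R A K (T := C) (S' := AK) (T' := AK ⊗[A] C)).2 h1.symm).symm

theorem exists_closed_piece {R R' C : Type u} [CommRing R]
    [CommRing R'] [Algebra R R'] [Algebra.Etale R R']
    {n l : ℕ} {b : R'}
    [CommRing C] [Algebra R C] [Algebra R' C] [IsScalarTower R R' C]
    [Algebra (stdRing R' n l b) C] [IsScalarTower R' (stdRing R' n l b) C]
    [Algebra.Etale (stdRing R' n l b) C] (i j : Fin n) (hi : (i : ℕ) < l)
    (g : R') (hg : g * b = 0) :
    ∃ (B : Type u) (_ : CommRing B) (_ : Algebra R B) (_ : Algebra C B), IsScalarTower R C B ∧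
      Algebra.Smooth R B ∧ algebraMap C B (algebraMap _ C (stdCoord R' n l b i)) = 0 ∧
      algebraMap C B (algebraMap _ C (stdCoord R' n l b j)) = 0 ∧
      IsUnit (algebraMap C B (algebraMap R' C g)) ∧
      (∀ x : B, ∃ (m : ℕ) (c : C), x * algebraMap C B (algebraMap R' C g) ^ m = algebraMap C B c) ∧
      ∀ p : Ideal C, p.IsPrime → algebraMap _ C (stdCoord R' n l b i) ∈ p →
        algebraMap _ C (stdCoord R' n l b j) ∈ p → algebraMap R' C g ∉ p →
        ∃ P : Ideal B, P.IsPrime ∧ P.comap (algebraMap C B) = p := by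
  have : Algebra.FinitePresentation R' C := .trans R' (stdRing R' n l b) C
  have : Algebra.FinitePresentation R C := .trans R R' C
  let h := algebraMap R' C g
  have : Algebra.FormallyEtale C (Localization.Away h) := .of_isLocalization (.powers h)
  have : Algebra.FormallyEtale (stdRing R' n l b) (Localization.Away h) := .comp _ C _
  have hu : IsUnit (algebraMap C (Localization.Away h) h) := IsLocalization.Away.algebraMap_isUnit h
  have hsm := std_smooth_two (R := R') (b := b) (T := Localization.Away h) i j hi g hg (by
      rw [IsScalarTower.algebraMap_apply R' C]
      exact hu)
  generalize hJ : Ideal.span {algebraMap (stdRing R' n l b) (Localization.Away h) (stdCoord R' n l b i),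
      algebraMap (stdRing R' n l b) (Localization.Away h) (stdCoord R' n l b j)} = J at hsm
  have hfg : J.FG := by
    rw [← hJ]
    exact Submodule.fg_span (Set.toFinite _)
  have : Algebra.FinitePresentation C (Localization.Away h) := IsLocalization.Away.finitePresentation h
  have : Algebra.FinitePresentation R (Localization.Away h) := .trans R C _
  have : Algebra.FinitePresentation R (Localization.Away h ⧸ J) := .quotient hfg
  have : Algebra.FormallySmooth R (Localization.Away h ⧸ J) := .comp R R' _
  refine ⟨Localization.Away h ⧸ J, inferInstance, inferInstance, inferInstance, inferInstance, ⟨‹_›, ‹_›⟩,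
    ?_, ?_, ?_, ?_, ?_⟩
  · exact Ideal.Quotient.eq_zero_iff_mem.2 (hJ ▸ Ideal.subset_span (by
      left; exact (IsScalarTower.algebraMap_apply _ C (Localization.Away h) _).symm))
  · exact Ideal.Quotient.eq_zero_iff_mem.2 (hJ ▸ Ideal.subset_span (by
      right; exact (IsScalarTower.algebraMap_apply _ C (Localization.Away h) _).symm))
  · exact hu.map (Ideal.Quotient.mk J)
  · intro x
    obtain ⟨x, rfl⟩ := Ideal.Quotient.mk_surjective x
    obtain ⟨m, c, hc⟩ := IsLocalization.Away.surj h x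
    refine ⟨m, c, ?_⟩
    have := congrArg (Ideal.Quotient.mk J) hc
    rw [map_mul, map_pow] at this
    exact this
  · intro p hp hip hjp hgp
    have hd : Disjoint (Submonoid.powers h : Set C) (p : Set C) :=
      (Ideal.disjoint_powers_iff_notMem_of_isPrime _).mpr hgp
    have hp1 := IsLocalization.isPrime_of_isPrime_disjoint (Submonoid.powers h)
      (Localization.Away h) p hp hd
    have hp2 := IsLocalization.under_map_of_isPrime_disjoint (Submonoid.powers h)
      (Localization.Away h) hp hd
    have hJp : J ≤ p.map (algebraMap C (Localization.Away h)) := by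
      rw [← hJ, Ideal.span_le]
      rintro _ (rfl | rfl)
      · rw [IsScalarTower.algebraMap_apply _ C (Localization.Away h)]
        exact Ideal.mem_map_of_mem _ hip
      · rw [IsScalarTower.algebraMap_apply _ C (Localization.Away h)]
        exact Ideal.mem_map_of_mem _ hjp
    refine ⟨(p.map (algebraMap C (Localization.Away h))).map (Ideal.Quotient.mk J),
      Ideal.map_isPrime_of_surjective Ideal.Quotient.mk_surjective (by rwa [Ideal.mk_ker]), ?_⟩
    rw [show algebraMap C (Localization.Away h ⧸ J) =
      (Ideal.Quotient.mk J).comp (algebraMap C (Localization.Away h)) from rfl, ← Ideal.comap_comap,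
      Ideal.comap_map_of_surjective' _ Ideal.Quotient.mk_surjective, Ideal.mk_ker, sup_eq_left.2 hJp]
    exact hp2
end NeronSemistable
end

section
open TensorProduct IsLocalRing AlgebraicGeometry CategoryTheory CategoryTheory.Limits
namespace NeronSemistable

theorem main_alg {R R' K L A AK AL C : Type u} [CommRing R] [HenselianLocalRing R]
    [IsSepClosed (ResidueField R)] [CommRing R'] [Algebra R R'] [Algebra.Etale R R']
    [Field K] [Algebra R K] [Module.Flat R K] [FaithfulSMul R K]
    [Field L] [Algebra R L] [Algebra K L] [IsScalarTower R K L]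
    {n l : ℕ} (hln : l ≤ n) {b : R'}
    [CommRing A] [Algebra R A] [Algebra.FiniteType R A]
    [CommRing AK] [Algebra R AK] [Algebra K AK] [Algebra A AK] [IsScalarTower R K AK]
    [IsScalarTower R A AK] [hAK : Algebra.IsPushout R K A AK]
    [CommRing AL] [Algebra K AL] [Algebra L AL] [Algebra AK AL]
    [IsScalarTower K L AL] [IsScalarTower K AK AL] [hAL : Algebra.IsPushout K L AK AL]
    [CommRing C] [Algebra R C] [Algebra R' C] [IsScalarTower R R' C]
    [Algebra (stdRing R' n l b) C] [IsScalarTower R' (stdRing R' n l b) C]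
    [Algebra.Etale (stdRing R' n l b) C]
    [Algebra A C] [IsScalarTower R A C] [Algebra.Etale A C]
    (P : Ideal C) [P.IsPrime] (hP : P.comap (algebraMap R C) = maximalIdeal R)
    (y : Ideal AK) [y.IsPrime] (hyP : y.comap (algebraMap A AK) ≤ P.comap (algebraMap A C))
    (hns : ¬ Algebra.IsSmoothAt K y)
    (hmax : ∀ z : Ideal AK, ∀ _ : z.IsPrime, z ≤ y → ¬ Algebra.IsSmoothAt K z → z = y)
    (v₁ v₂ : Ideal AL) [v₁.IsPrime] [v₂.IsPrime] (hv₁ : v₁.comap (algebraMap AK AL) = y)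
    (hv₂ : v₂.comap (algebraMap AK AL) = y) :
    ∃ v₀ : Ideal AL, v₀.IsPrime ∧ v₀.comap (algebraMap AK AL) = y ∧ v₀ ≤ v₁ ∧ v₀ ≤ v₂ := by
  -- step (i)
  obtain ⟨CK, _, _, _, _, _, _, _, _, _, _, _, _, _, hACK, hRCK⟩ := exists_pushout R K A AK C
  have : Algebra.Etale AK CK := .of_equiv (Algebra.IsPushout.equiv A AK C CK)
  have : Algebra.FiniteType K AK := .equiv inferInstance (Algebra.IsPushout.equiv R K A AK)
  obtain ⟨c, hcP, hc, hcy⟩ := Ideal.exists_ideal_le_liesOver_of_le (R := A)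
    (p := y.comap (algebraMap A AK)) (q := P.under A) P hyP
  obtain ⟨q, hq, hqy, hqc⟩ := pushout_prime (S := A) (W := CK) y c hcy.over
  have hqns : ¬ Algebra.IsSmoothAt K q := fun h => hns (smoothAt_descent y q hqy h)
  -- step (ii)
  let _ : Algebra R' CK := ((algebraMap C CK).comp (algebraMap R' C)).toAlgebra
  have : IsScalarTower R' C CK := .of_algebraMap_eq' rfl
  have : IsScalarTower R R' CK := .of_algebraMap_eq fun x => by
    rw [IsScalarTower.algebraMap_apply R' C CK, ← IsScalarTower.algebraMap_apply R R' C,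
      ← IsScalarTower.algebraMap_apply R C CK]
  obtain ⟨i, j, hij, hi, hj, hiq, hjq⟩ := exists_pair (K := K) hln (b := b) P hP q
    (hqc.trans_le hcP) hqns
  -- step (iii)
  have hs' : (P.comap (algebraMap R' C)).comap (algebraMap R R') = maximalIdeal R := by
    rw [Ideal.comap_comap, ← IsScalarTower.algebraMap_eq, hP]
  have hqP : ∀ x : C, algebraMap C CK x ∈ q → x ∈ P := fun x hx => hcP (hqc.le hx)
  obtain ⟨g, hg, hgb⟩ := exists_annihilator (R := R) (K := K) (P.comap (algebraMap R' C)) hs' q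
    (fun x hx => hqP _ hx) b (by
      have h1 := std_rel R' n l b
      rw [← Finset.mul_prod_erase _ _ (Finset.mem_univ i), if_pos hi] at h1
      rw [IsScalarTower.algebraMap_apply R' C CK,
        IsScalarTower.algebraMap_apply R' (stdRing R' n l b) C, ← h1, map_mul, map_mul]
      exact q.mul_mem_right _ hiq)
  obtain ⟨B, _, _, _, _, _, hBi, hBj, hBg, hBs, hBp⟩ := exists_closed_piece (R := R) (C := C)
    (b := b) i j hi g hgb
  have hgq : algebraMap C CK (algebraMap R' C g) ∉ q := fun h => hg (hqP _ h)
  obtain ⟨PB, hPB, hPBP⟩ := hBp P inferInstance (hqP _ hiq) (hqP _ hjq) hg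
  obtain ⟨cB, hcB, hcBc⟩ := hBp c hc (hqc.le hiq) (hqc.le hjq) (fun h => hgq (hqc.ge h))
  have hcPB : cB ≤ PB := by
    intro x hx
    obtain ⟨m, c', hc'⟩ := hBs x
    have h1 : algebraMap C B c' ∈ cB := hc' ▸ cB.mul_mem_right _ hx
    have h2 : algebraMap C B c' ∈ PB := hPBP.ge (hcP (hcBc.le h1))
    rw [← hc'] at h2
    exact (hPB.mem_or_mem h2).resolve_right
      (fun h => hPB.ne_top (Ideal.eq_top_of_isUnit_mem _ h (hBg.pow m)))
  have hPBR : PB.comap (algebraMap R B) = maximalIdeal R := by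
    rw [IsScalarTower.algebraMap_eq R C B, ← Ideal.comap_comap, hPBP, hP]
  -- step (iv)
  obtain ⟨BK, _, _, _, _, _, _, _, _, _, _, _, _, _, hCBK, hRBK⟩ := exists_pushout R K C CK B
  obtain ⟨qB, hqB, hqBq, hqBc⟩ := pushout_prime (S := C) (W := BK) q cB (hqc.trans hcBc.symm)
  obtain ⟨q₀, hq₀, hq₀q⟩ := Ideal.exists_minimalPrimes_le (bot_le (a := qB))
  have hq₀p : q₀.IsPrime := hq₀.1.1
  let _ : Algebra A B := ((algebraMap C B).comp (algebraMap A C)).toAlgebra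
  have : IsScalarTower A C B := .of_algebraMap_eq' rfl
  have : IsScalarTower R A B := .of_algebraMap_eq fun x => by
    rw [IsScalarTower.algebraMap_apply A C B, ← IsScalarTower.algebraMap_apply R A C,
      ← IsScalarTower.algebraMap_apply R C B]
  let _ : Algebra AK BK := ((algebraMap CK BK).comp (algebraMap AK CK)).toAlgebra
  have : IsScalarTower AK CK BK := .of_algebraMap_eq' rfl
  have : IsScalarTower K AK BK := .of_algebraMap_eq fun x => by
    rw [IsScalarTower.algebraMap_apply AK CK BK, ← IsScalarTower.algebraMap_apply K AK CK,
      ← IsScalarTower.algebraMap_apply K CK BK]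
  have hxBK : ∀ x : C, algebraMap C B x = 0 →
      algebraMap C CK x ∈ q₀.comap (algebraMap CK BK) := fun x hx => by
    rw [Ideal.mem_comap, ← IsScalarTower.algebraMap_apply C CK BK,
      IsScalarTower.algebraMap_apply C B BK, hx, map_zero]
    exact zero_mem _
  have hns0 : ¬ Algebra.IsSmoothAt K (q₀.comap (algebraMap CK BK)) :=
    not_smoothAt_of_pair (R := R) (b := b) _ i j hij hi hj (hxBK _ hBi) (hxBK _ hBj) g (by
      rw [Ideal.mem_comap, ← IsScalarTower.algebraMap_apply C CK BK,
        IsScalarTower.algebraMap_apply C B BK]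
      exact fun h => hq₀p.ne_top (Ideal.eq_top_of_isUnit_mem _ h (hBg.map _))) hgb
  have hq₀y : q₀.comap (algebraMap AK BK) = y := by
    apply hmax _ inferInstance
    · rw [IsScalarTower.algebraMap_eq AK CK BK, ← Ideal.comap_comap, ← hqy, ← hqBq]
      exact Ideal.comap_mono (Ideal.comap_mono hq₀q)
    · intro h
      refine hns0 (smoothAt_ascent (q₀.comap (algebraMap AK BK)) _ ?_ h)
      rw [Ideal.comap_comap, ← IsScalarTower.algebraMap_eq]
  -- step (v)
  obtain ⟨BL, _, _, _, _, _, _, _, _, _, _, _, _, _, hAKBL, hKBL⟩ := exists_pushout K L AK AL BK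
  let _ : Algebra R BL := ((algebraMap K BL).comp (algebraMap R K)).toAlgebra
  have : IsScalarTower R K BL := .of_algebraMap_eq' rfl
  let _ : Algebra B BL := ((algebraMap BK BL).comp (algebraMap B BK)).toAlgebra
  have : IsScalarTower B BK BL := .of_algebraMap_eq' rfl
  have : IsScalarTower R L BL := .of_algebraMap_eq fun x => by
    rw [IsScalarTower.algebraMap_apply R K BL, IsScalarTower.algebraMap_apply R K L,
      ← IsScalarTower.algebraMap_apply K L BL]
  have : IsScalarTower R BK BL := .of_algebraMap_eq fun x => by
    rw [IsScalarTower.algebraMap_apply R K BL, IsScalarTower.algebraMap_apply R K BK,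
      ← IsScalarTower.algebraMap_apply K BK BL]
  have : IsScalarTower R B BL := .of_algebraMap_eq fun x => by
    rw [IsScalarTower.algebraMap_apply R BK BL, IsScalarTower.algebraMap_apply R B BK,
      ← IsScalarTower.algebraMap_apply B BK BL]
  have hRBL : Algebra.IsPushout R L B BL :=
    (Algebra.IsPushout.comp_iff R K B (T := L) (S' := BK) (T' := BL)).2 hKBL
  have key : ∀ v : Ideal AL, v.IsPrime → v.comap (algebraMap AK AL) = y →
      ∃ Q ∈ minimalPrimes BL, Q.comap (algebraMap AL BL) ≤ v ∧
        Q.comap (algebraMap BK BL) = q₀ := by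
    intro v hv hvy
    obtain ⟨Q, hQ, hQv, hQq⟩ := pushout_prime (S := AK) (W := BL) v q₀ (hvy.trans hq₀y.symm)
    obtain ⟨Q₀, hQ₀, hQ₀Q⟩ := Ideal.exists_minimalPrimes_le (bot_le (a := Q))
    have hQ₀p : Q₀.IsPrime := hQ₀.1.1
    refine ⟨Q₀, hQ₀, ?_, ?_⟩
    · rw [← hQv]
      exact Ideal.comap_mono hQ₀Q
    · have h1 : Q₀.comap (algebraMap BK BL) ≤ q₀ := by
        rw [← hQq]
        exact Ideal.comap_mono hQ₀Q
      exact le_antisymm h1 (hq₀.2 ⟨inferInstance, bot_le⟩ h1)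
  obtain ⟨Q₁, hQ₁, hQ₁v, hQ₁q⟩ := key v₁ inferInstance hv₁
  obtain ⟨Q₂, hQ₂, hQ₂v, hQ₂q⟩ := key v₂ inferInstance hv₂
  have hle : ∀ Q : Ideal BL, Q.comap (algebraMap BK BL) = q₀ → Q.comap (algebraMap B BL) ≤ PB := by
    intro Q hQ
    rw [IsScalarTower.algebraMap_eq B BK BL, ← Ideal.comap_comap, hQ]
    refine le_trans ?_ hcPB
    rw [← hqBc]
    exact Ideal.comap_mono hq₀q
  have hQQ : Q₁ = Q₂ := minimalPrimes_unique' (R := R) (L := L) PB hPBR Q₁ Q₂ hQ₁ hQ₂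
    (hle _ hQ₁q) (hle _ hQ₂q)
  have hQ₁p : Q₁.IsPrime := hQ₁.1.1
  refine ⟨Q₁.comap (algebraMap AL BL), inferInstance, ?_, hQ₁v, hQQ ▸ hQ₂v⟩
  rw [Ideal.comap_comap, ← IsScalarTower.algebraMap_eq, IsScalarTower.algebraMap_eq AK BK BL,
    ← Ideal.comap_comap, hQ₁q, hq₀y]
end NeronSemistable
end

section
open TensorProduct IsLocalRing AlgebraicGeometry CategoryTheory CategoryTheory.Limits
namespace NeronSemistable

theorem exists_basechange_chart {R F A : Type u} [CommRing R] [CommRing F] [CommRing A]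
    [Algebra R F] [Algebra R A] {X XF : Scheme.{u}} (f : X ⟶ Spec (CommRingCat.of R))
    (p : XF ⟶ X) (g : XF ⟶ Spec (CommRingCat.of F))
    (h : IsPullback p g f (Spec.map (CommRingCat.ofHom (algebraMap R F))))
    (i : Spec (CommRingCat.of A) ⟶ X)
    (hi : i ≫ f = Spec.map (CommRingCat.ofHom (algebraMap R A))) :
    ∃ (AF : Type u) (_ : CommRing AF) (_ : Algebra R AF) (_ : Algebra F AF) (_ : Algebra A AF)
      (_ : IsScalarTower R F AF) (_ : IsScalarTower R A AF) (_ : Algebra.IsPushout R F A AF)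
      (j : Spec (CommRingCat.of AF) ⟶ XF),
      IsPullback j (Spec.map (CommRingCat.ofHom (algebraMap A AF))) p i ∧
        j ≫ g = Spec.map (CommRingCat.ofHom (algebraMap F AF)) := by
  let _ : Algebra A (F ⊗[R] A) := Algebra.TensorProduct.rightAlgebra
  have hpo : Algebra.IsPushout R F A (F ⊗[R] A) := inferInstance
  have hpb := isPullback_SpecMap_of_isPushout _ _ _ _
    (CommRingCat.isPushout_of_isPushout R F A (F ⊗[R] A))
  have w : (Spec.map (CommRingCat.ofHom (algebraMap A (F ⊗[R] A))) ≫ i) ≫ f =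
      Spec.map (CommRingCat.ofHom (algebraMap F (F ⊗[R] A))) ≫
        Spec.map (CommRingCat.ofHom (algebraMap R F)) := by
    rw [Category.assoc, hi, hpb.w]
  refine ⟨F ⊗[R] A, inferInstance, inferInstance, inferInstance, inferInstance, inferInstance,
    inferInstance, hpo, h.lift _ _ w, ?_, h.lift_snd _ _ w⟩
  refine IsPullback.of_right ?_ (h.lift_fst _ _ w) h.flip
  rw [h.lift_snd, hi]
  exact hpb

theorem smoothAtPt_iff {K B : Type u} [CommRing K] [CommRing B] [Algebra K B]
    [Algebra.FinitePresentation K B] {X : Scheme.{u}} (g : X ⟶ Spec (CommRingCat.of K))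
    (j : Spec (CommRingCat.of B) ⟶ X) [IsOpenImmersion j]
    (hj : j ≫ g = Spec.map (CommRingCat.ofHom (algebraMap K B)))
    (z : PrimeSpectrum B) :
    SmoothAtPt g (j z) ↔ Algebra.IsSmoothAt K z.asIdeal := by
  have key : ∀ r : B, Spec.map (CommRingCat.ofHom (algebraMap B (Localization.Away r))) ≫ j ≫ g =
      Spec.map (CommRingCat.ofHom (algebraMap K (Localization.Away r))) := by
    intro r
    rw [hj, ← Spec.map_comp, ← CommRingCat.ofHom_comp, ← IsScalarTower.algebraMap_eq]
  have hr : ∀ r : B, Set.range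
      (Spec.map (CommRingCat.ofHom (algebraMap B (Localization.Away r)))) =
      (PrimeSpectrum.basicOpen r : Set (PrimeSpectrum B)) := fun r =>
    PrimeSpectrum.localization_away_comap_range (Localization.Away r) r
  constructor
  · rintro ⟨U, hzU, hU⟩
    have hU' : Smooth (U.ι ≫ g) := hU
    have hop : IsOpen {t : PrimeSpectrum B | j t ∈ U} := (j ⁻¹ᵁ U).2
    obtain ⟨_, ⟨r, rfl⟩, hzr, hrU⟩ :=
      PrimeSpectrum.isTopologicalBasis_basic_opens.exists_subset_of_mem_open
        (show z ∈ {t : PrimeSpectrum B | j t ∈ U} from hzU) hop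
    let e := Spec.map (CommRingCat.ofHom (algebraMap B (Localization.Away r))) ≫ j
    have hle : Set.range e ⊆ Set.range U.ι := by
      rintro _ ⟨t, rfl⟩
      rw [Scheme.Opens.range_ι]
      exact hrU ((hr r).le ⟨t, rfl⟩)
    have h1 : Smooth (e ≫ g) := by
      rw [← IsOpenImmersion.lift_fac U.ι e hle, Category.assoc]
      have : IsOpenImmersion (IsOpenImmersion.lift U.ι e hle) := inferInstance
      infer_instance
    rw [show e ≫ g = _ from by rw [Category.assoc, key],
      HasRingHomProperty.Spec_iff (P := @Smooth)] at h1
    have h2 : Algebra.Smooth K (Localization.Away r) := RingHom.smooth_algebraMap.mp h1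
    have := h2.formallySmooth
    exact Algebra.basicOpen_subset_smoothLocus_iff.mpr this hzr
  · intro h
    obtain ⟨r, hrz, hs⟩ := Algebra.IsSmoothAt.exists_notMem_smooth K z.asIdeal
    let e := Spec.map (CommRingCat.ofHom (algebraMap B (Localization.Away r))) ≫ j
    have h1 : Smooth (e ≫ g) := by
      rw [show e ≫ g = _ from by rw [Category.assoc, key],
        HasRingHomProperty.Spec_iff (P := @Smooth)]
      exact RingHom.smooth_algebraMap.mpr hs
    refine ⟨e.opensRange, ?_, ?_⟩
    · obtain ⟨t, ht⟩ := (hr r).ge hrz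
      exact ⟨t, congrArg j ht⟩
    · change Smooth _
      rw [← Scheme.Hom.isoOpensRange_inv_comp e, Category.assoc]
      infer_instance

theorem flat_of_injective_field {R K : Type u} [CommRing R] [IsDomain R] [Field K] [Algebra R K]
    (h : Function.Injective (algebraMap R K)) : Module.Flat R K := by
  have : FaithfulSMul R K := (faithfulSMul_iff_algebraMap_injective R K).2 h
  let _ : Algebra (FractionRing R) K := FractionRing.liftAlgebra R K
  have : IsScalarTower R (FractionRing R) K := inferInstance
  exact Module.Flat.trans R (FractionRing R) K
end NeronSemistable
end

section
open TensorProduct IsLocalRing AlgebraicGeometry CategoryTheory CategoryTheory.Limits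
namespace NeronSemistable

theorem exists_alg_chart {R : Type u} [CommRing R] {X : Scheme.{u}}
    (f : X ⟶ Spec (CommRingCat.of R)) [LocallyOfFiniteType f] (x : X) (D : ChartData f x) :
    ∃ (R' A C : Type u) (_ : CommRing R') (_ : CommRing A) (_ : CommRing C)
      (_ : Algebra R R') (_ : Algebra.Etale R R') (n l : ℕ) (_ : l ≤ n) (b : R')
      (_ : Algebra R A) (_ : Algebra.FiniteType R A)
      (_ : Algebra R C) (_ : Algebra R' C) (_ : IsScalarTower R R' C)
      (_ : Algebra (stdRing R' n l b) C) (_ : IsScalarTower R' (stdRing R' n l b) C)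
      (_ : Algebra.Etale (stdRing R' n l b) C)
      (_ : Algebra A C) (_ : IsScalarTower R A C) (_ : Algebra.Etale A C)
      (i : Spec (CommRingCat.of A) ⟶ X) (_ : IsOpenImmersion i) (P : PrimeSpectrum C),
      i ≫ f = Spec.map (CommRingCat.ofHom (algebraMap R A)) ∧
        i (PrimeSpectrum.comap (algebraMap A C) P) = x := by
  obtain ⟨A, i, hi, hxi, -⟩ := Scheme.exists_affine_mem_range_and_range_subset
    (show x ∈ (⊤ : X.Opens) from trivial)
  obtain ⟨C, c, hc, hxc, hci⟩ := Scheme.exists_affine_mem_range_and_range_subset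
    (show D.x' ∈ D.gX ⁻¹ᵁ i.opensRange from by
      change D.gX D.x' ∈ i.opensRange
      rw [show D.gX D.x' = x from D.hx']
      exact hxi)
  have : Etale D.gX := D.gX_etale
  have : Etale D.gT := D.gT_etale
  have hcT : Etale (c ≫ D.gT) := inferInstance
  have : Etale D.etS := D.etS_etale
  have hle : Set.range (c ≫ D.gX) ⊆ Set.range i := by
    rintro _ ⟨t, rfl⟩
    exact hci ⟨t, rfl⟩
  let h := IsOpenImmersion.lift i (c ≫ D.gX) hle
  have hh : h ≫ i = c ≫ D.gX := IsOpenImmersion.lift_fac i (c ≫ D.gX) hle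
  have hhe : Etale h := by
    have : Etale (h ≫ i) := by rw [hh]; infer_instance
    exact MorphismProperty.of_postcomp @Etale h i (show Etale i from inferInstance) this
  let φ := Spec.preimage D.etS
  let α := Spec.preimage (i ≫ f)
  let χ := Spec.preimage h
  let τ : CommRingCat.of (stdRing D.R D.n D.l D.b) ⟶ C := Spec.preimage (c ≫ D.gT)
  have hφ : Spec.map φ = D.etS := Spec.map_preimage _
  have hα : Spec.map α = i ≫ f := Spec.map_preimage _
  have hχ : Spec.map χ = h := Spec.map_preimage _
  have hτ : Spec.map τ = c ≫ D.gT := Spec.map_preimage _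
  let σ : D.R ⟶ CommRingCat.of (stdRing D.R D.n D.l D.b) :=
    CommRingCat.ofHom (algebraMap D.R (stdRing D.R D.n D.l D.b))
  have hσ : Spec.map σ = stdSpec D.R D.n D.l D.b := rfl
  have hcomm : α ≫ χ = φ ≫ σ ≫ τ := by
    apply Spec.map_injective
    rw [Spec.map_comp, Spec.map_comp, Spec.map_comp, hφ, hα, hχ, hτ, hσ, ← Category.assoc h, hh,
      Category.assoc, ← D.comm]
    exact (show c ≫ D.gT ≫ stdSpec D.R D.n D.l D.b ≫ D.etS =
      ((c ≫ D.gT) ≫ stdSpec D.R D.n D.l D.b) ≫ D.etS by simp only [Category.assoc])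
  let _ : Algebra R D.R := φ.hom.toAlgebra
  let _ : Algebra R A := α.hom.toAlgebra
  let _ : Algebra A C := χ.hom.toAlgebra
  let _ : Algebra (stdRing D.R D.n D.l D.b) C := τ.hom.toAlgebra
  let _ : Algebra D.R C := (τ.hom.comp (algebraMap D.R (stdRing D.R D.n D.l D.b))).toAlgebra
  let _ : Algebra R C := (χ.hom.comp α.hom).toAlgebra
  have htow : IsScalarTower D.R (stdRing D.R D.n D.l D.b) C :=
    ⟨fun x y z => by
      change τ.hom (x • y) * z = τ.hom (algebraMap _ _ x) * (τ.hom y * z)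
      have h1 : x • y = algebraMap D.R (stdRing D.R D.n D.l D.b) x * y := Algebra.smul_def x y
      rw [h1, map_mul, mul_assoc]⟩
  obtain ⟨P, hP⟩ := hxc
  refine ⟨D.R, A, C, inferInstance, inferInstance, inferInstance, inferInstance, ?_, D.n, D.l,
    D.hln, D.b, inferInstance, ?_, inferInstance, inferInstance, ?_, inferInstance,
    htow, ?_, inferInstance, .of_algebraMap_eq' rfl, ?_, i, hi, P, hα.symm, ?_⟩
  · rw [← RingHom.etale_algebraMap]
    exact (HasRingHomProperty.Spec_iff (P := @Etale)).mp (hφ ▸ ‹Etale D.etS›)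
  · have : LocallyOfFiniteType (Spec.map α) := by rw [hα]; infer_instance
    exact (HasRingHomProperty.Spec_iff (P := @LocallyOfFiniteType)).mp this
  · exact .of_algebraMap_eq' congr(($hcomm).hom)
  · rw [← RingHom.etale_algebraMap]
    have : Etale (Spec.map τ) := by rw [hτ]; exact hcT
    exact (HasRingHomProperty.Spec_iff (P := @Etale)).mp this
  · rw [← RingHom.etale_algebraMap]
    exact (HasRingHomProperty.Spec_iff (P := @Etale)).mp (hχ ▸ hhe)
  · have h1 : h P = PrimeSpectrum.comap (algebraMap A C) P := by rw [← hχ]; rfl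
    rw [← h1, ← Scheme.Hom.comp_apply, hh, Scheme.Hom.comp_apply, hP]
    exact D.hx'
end NeronSemistable
end

section
open TensorProduct IsLocalRing AlgebraicGeometry CategoryTheory CategoryTheory.Limits
namespace NeronSemistable

theorem exists_common_generization {R K L : Type u} [CommRing R] [HenselianLocalRing R]
    [IsSepClosed (ResidueField R)] [Field K] [Algebra R K] [Module.Flat R K] [FaithfulSMul R K]
    [Field L] [Algebra K L] {X XK XL : Scheme.{u}} (f : X ⟶ Spec (CommRingCat.of R))
    [LocallyOfFiniteType f] (p : XK ⟶ X) (g : XK ⟶ Spec (CommRingCat.of K))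
    (hK : IsPullback p g f (Spec.map (CommRingCat.ofHom (algebraMap R K))))
    (q : XL ⟶ XK) (gL : XL ⟶ Spec (CommRingCat.of L))
    (hL : IsPullback q gL g (Spec.map (CommRingCat.ofHom (algebraMap K L))))
    (x : X) (D : ChartData f x) (hx : f x = closedPoint R) (y : XK) (hyx : p y ⤳ x)
    (hns : ¬ SmoothAtPt g y) (hmax : ∀ z : XK, z ⤳ y → ¬ SmoothAtPt g z → z = y)
    (w₁ w₂ : XL) (hw₁ : q w₁ = y) (hw₂ : q w₂ = y) :
    ∃ w₀ : XL, q w₀ = y ∧ w₀ ⤳ w₁ ∧ w₀ ⤳ w₂ := by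
  obtain ⟨R', A, C, _, _, _, _, _, n, l, hln, b, _, _, _, _, _, _, _, _, _, _, _, i, _, P, hif,
    hiP⟩ := exists_alg_chart f x D
  obtain ⟨AK, _, _, _, _, _, _, _, j, hj, hjg⟩ := exists_basechange_chart f p g hK i hif
  obtain ⟨AL, _, _, _, _, _, _, _, jL, hjL, hjgL⟩ := exists_basechange_chart g q gL hL j hjg
  let _ : Algebra R L := ((algebraMap K L).comp (algebraMap R K)).toAlgebra
  have : IsScalarTower R K L := .of_algebraMap_eq' rfl
  have hjo : IsOpenImmersion j := MorphismProperty.of_isPullback hj.flip ‹IsOpenImmersion i›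
  have hjLo : IsOpenImmersion jL := MorphismProperty.of_isPullback hjL.flip hjo
  have : Algebra.FiniteType K AK := .equiv inferInstance (Algebra.IsPushout.equiv R K A AK)
  have : Algebra.FinitePresentation K AK := Algebra.FinitePresentation.of_finiteType.mp this
  -- the point `a`
  obtain ⟨a, ha⟩ : p y ∈ Set.range i := hyx.mem_open i.isOpenEmbedding.isOpen_range ⟨_, hiP⟩
  obtain ⟨y', hy'y, hy'a⟩ := Scheme.exists_preimage_of_isPullback hj y a ha.symm
  have hex : ∀ w : XL, q w = y → ∃ v : PrimeSpectrum AL, jL v = w ∧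
      PrimeSpectrum.comap (algebraMap AK AL) v = y' := fun w hw =>
    Scheme.exists_preimage_of_isPullback hjL w y' (hw.trans hy'y.symm)
  obtain ⟨v₁, hv₁, hv₁y⟩ := hex w₁ hw₁
  obtain ⟨v₂, hv₂, hv₂y⟩ := hex w₂ hw₂
  have hP : P.asIdeal.comap (algebraMap R C) = maximalIdeal R := by
    have h1 : (i ≫ f) (PrimeSpectrum.comap (algebraMap A C) P) = closedPoint R :=
      (Scheme.Hom.comp_apply i f _).trans ((congrArg f hiP).trans hx)
    rw [hif] at h1
    have h2 := congrArg PrimeSpectrum.asIdeal h1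
    rw [IsScalarTower.algebraMap_eq R A C, ← Ideal.comap_comap]
    exact h2
  have hyP : y'.asIdeal.comap (algebraMap A AK) ≤ P.asIdeal.comap (algebraMap A C) := by
    have h1 : i a ⤳ i (PrimeSpectrum.comap (algebraMap A C) P) := by rwa [ha, hiP]
    have h2 := i.isOpenEmbedding.isInducing.specializes_iff.mp h1
    rw [← hy'a] at h2
    exact (PrimeSpectrum.le_iff_specializes _ _).mpr h2
  have hy'p : y'.asIdeal.IsPrime := PrimeSpectrum.isPrime (R := AK) y'
  obtain ⟨v₀, hv₀, hv₀y, h₁, h₂⟩ := main_alg (R := R) (R' := R') (K := K) (L := L) (A := A)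
    (AK := AK) (AL := AL) (C := C) hln (b := b) P.asIdeal hP y'.asIdeal hyP
    (fun h => hns (hy'y ▸ (smoothAtPt_iff g j hjg y').mpr h))
    (fun z hz hzy hzs => by
      have h1 : j (⟨z, hz⟩ : PrimeSpectrum AK) ⤳ y := by
        rw [← hy'y]
        exact ((PrimeSpectrum.le_iff_specializes (⟨z, hz⟩ : PrimeSpectrum AK) y').mp hzy).map
          j.continuous
      have h2 := hmax _ h1 (fun h => hzs ((smoothAtPt_iff g j hjg ⟨z, hz⟩).mp h))
      rw [← hy'y] at h2
      exact congrArg PrimeSpectrum.asIdeal (j.isOpenEmbedding.injective h2))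
    v₁.asIdeal v₂.asIdeal (congrArg PrimeSpectrum.asIdeal hv₁y)
    (congrArg PrimeSpectrum.asIdeal hv₂y)
  refine ⟨jL (⟨v₀, hv₀⟩ : PrimeSpectrum AL), ?_, ?_, ?_⟩
  · refine (Scheme.Hom.comp_apply jL q _).symm.trans ?_
    rw [hjL.w, ← hy'y]
    exact (Scheme.Hom.comp_apply _ j _).trans (congrArg j (PrimeSpectrum.ext hv₀y))
  · rw [← hv₁]
    exact ((PrimeSpectrum.le_iff_specializes (⟨v₀, hv₀⟩ : PrimeSpectrum AL) v₁).mp h₁).map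
      jL.continuous
  · rw [← hv₂]
    exact ((PrimeSpectrum.le_iff_specializes (⟨v₀, hv₀⟩ : PrimeSpectrum AL) v₂).mp h₂).map
      jL.continuous
end NeronSemistable
end

noncomputable section
namespace NeronSemistable

theorem isClosed_nonsmooth {X S : Scheme.{u}} (g : X ⟶ S) :
    IsClosed {z : X | ¬ SmoothAtPt g z} := by
  rw [← isOpen_compl_iff]
  refine isOpen_iff_forall_mem_open.mpr fun x hx => ?_
  obtain ⟨U, hxU, hU⟩ : SmoothAtPt g x := not_not.mp hx
  exact ⟨U, fun z hz => not_not.mpr ⟨U, hz, hU⟩, U.2, hxU⟩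

theorem exists_generic_of_component {X S : Scheme.{u}} (g : X ⟶ S)
    (Y : Set {z : X // ¬ SmoothAtPt g z})
    (hY : Y ∈ irreducibleComponents {z : X // ¬ SmoothAtPt g z}) :
    IsIrreducible (Subtype.val '' Y) ∧ ∃ y : X, IsGenericPoint y (Subtype.val '' Y) ∧
      ¬ SmoothAtPt g y ∧ ∀ z : X, z ⤳ y → ¬ SmoothAtPt g z → z = y := by
  have hirr : IsIrreducible (Subtype.val '' Y) := hY.1.image _ continuous_subtype_val.continuousOn
  have hcl : IsClosed (Subtype.val '' Y) :=
    (isClosed_nonsmooth g).isClosedEmbedding_subtypeVal.isClosedMap _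
      (isClosed_of_mem_irreducibleComponents _ hY)
  obtain ⟨y, hy⟩ := QuasiSober.sober hirr hcl
  refine ⟨hirr, y, hy, ?_, fun z hzy hz => ?_⟩
  · obtain ⟨y', -, hy'⟩ := hy.mem
    exact hy' ▸ y'.2
  · have h1 : Y ≤ closure {(⟨z, hz⟩ : {z : X // ¬ SmoothAtPt g z})} := by
      intro t ht
      rw [closure_subtype, Set.image_singleton]
      have h2 : y ⤳ t.1 := hy.specializes ⟨t, ht, rfl⟩
      exact (hzy.trans h2).mem_closure
    have h3 := hY.2 isIrreducible_singleton.closure h1 (subset_closure rfl)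
    have h4 : y ⤳ z := hy.specializes ⟨_, h3, rfl⟩
    exact (hzy.antisymm h4).eq

/-- Corollary 3.9 of the paper.  Let `S = Spec R` with `R` an integral
Noetherian strictly henselian local ring with closed point `s` and generic point `η`, and
`f : X ⟶ S` semistable.  Then every irreducible component of the non-smooth locus of the
generic fibre `X_η` is geometrically irreducible. -/
theorem component_of_nonsmooth_locus_geometrically_irreducible
    (R : CommRingCat.{u}) [IsDomain ↥R] (hNoeth : IsNoetherianRing ↥R)
    (hsh : StrictlyHenselianLocal ↥R)
    {X : Scheme.{u}} (f : X ⟶ Spec R) (hss : IsSemistable f)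
    (η : ↑(Spec R)) (hη : closure {η} = Set.univ)
    (Y : Set {z : fiberScheme f η // ¬ SmoothAtPt (fiberRes f η) z})
    (hY : Y ∈ irreducibleComponents {z : fiberScheme f η // ¬ SmoothAtPt (fiberRes f η) z}) :
    GeomIrreducibleOver ((Spec R).residueField η) (fiberRes f η)
      (Subtype.val '' Y) := by
  obtain ⟨hprop, -, hchart⟩ := hss
  obtain ⟨hloc, hhens, hsep⟩ := hsh
  obtain ⟨hirr, y, hy, hyns, hymax⟩ := exists_generic_of_component _ Y hY
  -- a point over the closed point in the closure of `y`
  let p : fiberScheme f η ⟶ X := fiberι f η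
  have hcl : IsClosed (f '' closure {p y}) := f.isClosedMap _ isClosed_closure
  have h0 : f (p y) ⤳ IsLocalRing.closedPoint R := IsLocalRing.specializes_closedPoint _
  obtain ⟨x, hx, hfx⟩ := h0.mem_closed hcl ⟨p y, subset_closure rfl, rfl⟩
  have hyx : p y ⤳ x := specializes_iff_mem_closure.mpr hx
  obtain ⟨D⟩ := hchart x
  -- the residue field
  let φ : R ⟶ (Spec R).residueField η := Spec.preimage ((Spec R).fromSpecResidueField η)
  have hφ : Spec.map φ = (Spec R).fromSpecResidueField η := Spec.map_preimage _
  let _ : Algebra R ((Spec R).residueField η) := φ.hom.toAlgebra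
  have hinj : Function.Injective (algebraMap R ((Spec R).residueField η)) := by
    rw [injective_iff_map_eq_zero]
    intro a ha
    have h1 : Spec.map φ (default : PrimeSpectrum ((Spec R).residueField η)) = η := by
      rw [hφ]
      have : Spec.map φ (default : PrimeSpectrum ((Spec R).residueField η)) ∈
        Set.range ((Spec R).fromSpecResidueField η) := by rw [hφ]; exact ⟨_, rfl⟩
      rw [Scheme.range_fromSpecResidueField, hφ] at this
      exact this
    have h2 : a ∈ η.asIdeal := by
      rw [← h1]
      change φ.hom a ∈ (default : PrimeSpectrum ((Spec R).residueField η)).asIdeal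
      rw [show φ.hom a = 0 from ha]
      exact zero_mem _
    have h3 : η ⤳ (⊥ : PrimeSpectrum R) :=
      specializes_iff_mem_closure.mpr (hη ▸ Set.mem_univ _)
    exact (PrimeSpectrum.le_iff_specializes _ _).mpr h3 h2
  have hflat := flat_of_injective_field hinj
  have hfaith : FaithfulSMul R ((Spec R).residueField η) :=
    (faithfulSMul_iff_algebraMap_injective R _).2 hinj
  have hpb : IsPullback p (fiberRes f η) f
      (Spec.map (CommRingCat.ofHom (algebraMap R ((Spec R).residueField η)))) := by
    change IsPullback _ _ f (Spec.map φ)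
    rw [hφ]
    exact IsPullback.of_hasPullback f ((Spec R).fromSpecResidueField η)
  intro L _ ψ
  let _ : Algebra ((Spec R).residueField η) L := ψ.hom.toAlgebra
  have hq : IsPullback (pullback.fst (fiberRes f η) (Spec.map ψ)) (pullback.snd _ _)
      (fiberRes f η) (Spec.map ψ) := IsPullback.of_hasPullback _ _
  have hfib : IsPreirreducible ((pullback.fst (fiberRes f η) (Spec.map ψ)) ⁻¹' {y}) := by
    rintro U₁ U₂ hU₁ hU₂ ⟨w₁, hw₁, hw₁U⟩ ⟨w₂, hw₂, hw₂U⟩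
    obtain ⟨w₀, hw₀, h₁, h₂⟩ := exists_common_generization (R := R)
      (K := (Spec R).residueField η) (L := L) f p (fiberRes f η) hpb _ _ hq x D hfx y hyx hyns
      hymax w₁ w₂ hw₁ hw₂
    exact ⟨w₀, hw₀, h₁.mem_open hU₁ hw₁U, h₂.mem_open hU₂ hw₂U⟩
  have hsub : Subsingleton (Spec ((Spec R).residueField η)) :=
    inferInstanceAs (Subsingleton (PrimeSpectrum ((Spec R).residueField η)))
  refine ⟨?_, hirr.2.preimage_of_dense_isPreirreducible_fiber _ ?_ ?_⟩
  · obtain ⟨w, hw, -⟩ := Scheme.exists_preimage_of_isPullback hq y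
      (default : PrimeSpectrum L) (Subsingleton.elim _ _)
    exact ⟨w, Set.mem_preimage.mpr (hw ▸ hy.mem)⟩
  · have : UniversallyOpen (Spec.map ψ) := inferInstance
    exact (pullback.fst (fiberRes f η) (Spec.map ψ)).isOpenMap
  · intro t ht
    have h1 : y ⤳ t := hy.specializes ht
    refine closure_mono ?_ h1.mem_closure
    rintro _ rfl
    exact ⟨hy.mem, hfib⟩
end NeronSemistable
end
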